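/- For every integer n ≥ 3 there exist a Ważewski dendrite X of order n and a finitely generated subgroup G of Homeo(X), dense in Homeo(X), whose commutator subgroup [G,G] is itself finitely generated. -/

import Mathlib

open Topology

/-- The set of connected components of a subset `S` of `X`. -/
def setComponents (X : Type*) [TopologicalSpace X] (S : Set X) : Set (Set X) :=
  {C | ∃ x ∈ S, C = connectedComponentIn S x}

/-- The order of a point `p` of `X`: the number of connected components of `X \ {p}`. -/
noncomputable def ptOrder (X : Type*) [TopologicalSpace X] (p : X) : ℕ :=
  (setComponents X {p}ᶜ).ncard

/-- A dendrite: a nonempty, compact, connected, locally connected metrizable space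
containing no subspace homeomorphic to the circle. -/
def IsDendrite (X : Type*) [TopologicalSpace X] : Prop :=
  Nonempty X ∧ CompactSpace X ∧ ConnectedSpace X ∧ LocallyConnectedSpace X ∧
    TopologicalSpace.MetrizableSpace X ∧
    ∀ S : Set X, IsEmpty (S ≃ₜ Circle)

/-- A Ważewski dendrite of order `n`: a dendrite all of whose points have order `1`, `2`
or `n`, and every arc (subspace homeomorphic to `[0,1]`) contains a point of order `n`. -/
def IsWazewskiDendrite (n : ℕ) (X : Type*) [TopologicalSpace X] : Prop :=
  IsDendrite X ∧
  (∀ p : X, ptOrder X p = 1 ∨ ptOrder X p = 2 ∨ ptOrder X p = n) ∧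
  ∀ A : Set X, Nonempty (A ≃ₜ unitInterval) → ∃ p ∈ A, ptOrder X p = n

/-- The group structure on self-homeomorphisms of `X`, with composition as product. -/
instance Homeomorph.instGroupSelf (X : Type*) [TopologicalSpace X] : Group (X ≃ₜ X) where
  mul f g := g.trans f
  one := Homeomorph.refl X
  inv := Homeomorph.symm
  mul_assoc _ _ _ := rfl
  one_mul _ := Homeomorph.ext fun _ => rfl
  mul_one _ := Homeomorph.ext fun _ => rfl
  inv_mul_cancel := Homeomorph.self_trans_symm

/-- The compact-open topology on the group of self-homeomorphisms of `X` (for compact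
metric `X`, this is the topology of uniform convergence). -/
instance Homeomorph.instTopSelf (X : Type*) [TopologicalSpace X] :
    TopologicalSpace (X ≃ₜ X) :=
  TopologicalSpace.induced (fun h : X ≃ₜ X => (h : C(X, X))) ContinuousMap.compactOpen

structure Dend (m : ℕ) (X : Type) [MetricSpace X] where
  f : Fin (m + 3) → X → X
  e0 : X
  e1 : X
  cover : ∀ x, ∃ i y, x = f i y
  dist_same : ∀ i x y, dist (f i x) (f i y) = dist x y / 2
  dist_ne : ∀ i j x y, i ≠ j → dist (f i x) (f j y) = (dist e0 x + dist e0 y) / 2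
  f0e1 : f 0 e1 = e0
  f1e1 : f 1 e1 = e1
  dist_le : ∀ x y : X, dist x y ≤ 1
  ne : e0 ≠ e1

namespace Dend

variable {m : ℕ} {X : Type} [MetricSpace X] (D : Dend m X)

/-- the central branch point -/
def c : X := D.f 0 D.e0

theorem f_e0 (i : Fin (m + 3)) : D.f i D.e0 = D.c := by
  by_cases h : i = 0
  · subst h; rfl
  · apply dist_le_zero.1
    rw [c, D.dist_ne i 0 _ _ h]; simp

theorem f_inj (i : Fin (m + 3)) : Function.Injective (D.f i) := by
  intro x y h
  have := D.dist_same i x y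
  rw [h, dist_self] at this
  exact dist_le_zero.1 (by linarith)

theorem f_ne {i j : Fin (m + 3)} (hij : i ≠ j) {x y : X} (h : D.f i x = D.f j y) :
    x = D.e0 ∧ y = D.e0 := by
  have := D.dist_ne i j x y hij
  rw [h, dist_self] at this
  have h1 := dist_nonneg (x := D.e0) (y := x)
  have h2 := dist_nonneg (x := D.e0) (y := y)
  exact ⟨(dist_le_zero.1 (by linarith)).symm, (dist_le_zero.1 (by linarith)).symm⟩

theorem f_eq_c {i : Fin (m + 3)} {x : X} (h : D.f i x = D.c) : x = D.e0 :=
  D.f_inj i (h.trans (D.f_e0 i).symm)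

theorem c_ne_e0 : D.c ≠ D.e0 := by
  intro h
  have h2 := D.f0e1.trans h.symm
  exact D.ne (D.f_eq_c h2).symm

theorem c_ne_e1 : D.c ≠ D.e1 := by
  intro h
  have h2 := D.f1e1.trans h.symm
  exact D.ne (D.f_eq_c h2).symm

theorem f_ne_e0 {i : Fin (m + 3)} (hi : i ≠ 0) (x : X) : D.f i x ≠ D.e0 := by
  intro h
  rw [← D.f0e1] at h
  exact D.ne (D.f_ne hi h).2.symm

theorem f_continuous (i : Fin (m + 3)) : Continuous (D.f i) := by
  have : LipschitzWith 1 (D.f i) := LipschitzWith.of_dist_le_mul fun x y => by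
    rw [D.dist_same]; have := dist_nonneg (x := x) (y := y); simp
  exact this.continuous

open Classical in
/-- glue maps defined on the cells -/
noncomputable def glue {Y : Type} (g : Fin (m + 3) → X → Y) (x : X) : Y :=
  g (D.cover x).choose (D.cover x).choose_spec.choose

theorem glue_f {Y : Type} {g : Fin (m + 3) → X → Y} (hg : ∀ i j, g i D.e0 = g j D.e0) (i : Fin (m + 3))
    (x : X) : D.glue g (D.f i x) = g i x := by
  have key : ∀ j y, D.f i x = D.f j y → g j y = g i x := by
    intro j y h
    by_cases hij : i = j
    · subst hij
      rw [D.f_inj i h]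
    · obtain ⟨h1, h2⟩ := D.f_ne hij h
      rw [h2, h1]; exact hg _ _
  exact key _ _ (D.cover (D.f i x)).choose_spec.choose_spec

theorem f_closedEmb [CompactSpace X] (i : Fin (m + 3)) : IsClosedEmbedding (D.f i) :=
  (D.f_continuous i).isClosedEmbedding (D.f_inj i)

theorem glue_continuous [CompactSpace X] {Y : Type} [TopologicalSpace Y] {g : Fin (m + 3) → X → Y}
    (hg : ∀ i j, g i D.e0 = g j D.e0) (hc : ∀ i, Continuous (g i)) : Continuous (D.glue g) := by
  rw [continuous_iff_isClosed]
  intro Z hZ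
  have : D.glue g ⁻¹' Z = ⋃ i, D.f i '' (g i ⁻¹' Z) := by
    ext x
    simp only [Set.mem_preimage, Set.mem_iUnion, Set.mem_image]
    constructor
    · intro h
      obtain ⟨i, y, rfl⟩ := D.cover x
      rw [D.glue_f hg] at h
      exact ⟨i, y, h, rfl⟩
    · rintro ⟨i, y, h, rfl⟩
      rwa [D.glue_f hg]
  rw [this]
  exact isClosed_iUnion_of_finite fun i => (D.f_closedEmb i).isClosedMap _ (hZ.preimage (hc i))

theorem ext_f {Y : Type} {u v : X → Y} (h : ∀ i x, u (D.f i x) = v (D.f i x)) (x : X) : u x = v x := by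
  obtain ⟨i, y, rfl⟩ := D.cover x
  exact h i y

/-- retraction onto a cell -/
noncomputable def r (i : Fin (m + 3)) : X → X := D.glue fun j => if j = i then id else fun _ => D.e0

theorem r_compat (i : Fin (m + 3)) : ∀ j k, (if j = i then id else fun _ => D.e0 : X → X) D.e0 =
    (if k = i then id else fun _ => D.e0 : X → X) D.e0 := by
  intro j k; split_ifs <;> rfl

theorem r_same (i : Fin (m + 3)) (x : X) : D.r i (D.f i x) = x := by
  rw [r, D.glue_f (D.r_compat i)]; simp

theorem r_ne {i j : Fin (m + 3)} (h : j ≠ i) (x : X) : D.r i (D.f j x) = D.e0 := by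
  rw [r, D.glue_f (D.r_compat i)]; simp [h]

theorem r_continuous [CompactSpace X] (i : Fin (m + 3)) : Continuous (D.r i) := by
  apply D.glue_continuous (D.r_compat i)
  intro j
  split_ifs
  · exact continuous_id
  · exact continuous_const

theorem r_eq {i : Fin (m + 3)} {x b : X} (hb : b ≠ D.e0) (h : D.r i x = b) : x = D.f i b := by
  obtain ⟨j, y, rfl⟩ := D.cover x
  by_cases hj : j = i
  · subst hj; rw [r_same] at h; rw [h]
  · rw [D.r_ne hj] at h; exact absurd h.symm hb

/-! connectedness -/

theorem const_of_step (D : Dend m X) {g : X → Bool} (k : ℕ) (h : ∀ x y, dist x y ≤ (1 / 2) ^ k → g x = g y) :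
    ∀ x y, g x = g y := by
  induction k generalizing g with
  | zero => intro x y; exact h x y (by simpa using D.dist_le x y)
  | succ k ih =>
    have key : ∀ i x, g (D.f i x) = g D.c := by
      intro i x
      rw [← D.f_e0 i]
      exact ih (g := g ∘ D.f i) (fun x y hxy => h _ _ (by
        rw [D.dist_same, pow_succ]; linarith)) x D.e0
    intro x y
    obtain ⟨i, x, rfl⟩ := D.cover x
    obtain ⟨j, y, rfl⟩ := D.cover y
    rw [key, key]

theorem preconn (D : Dend m X) [CompactSpace X] : PreconnectedSpace X := by
  constructor
  apply isPreconnected_of_forall_constant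
  intro g hg x _ y _
  rw [continuousOn_univ] at hg
  have hg' : Continuous (fun x => if g x then (1 : ℝ) else 0) :=
    (continuous_of_discreteTopology (f := fun b : Bool => if b then (1 : ℝ) else 0)).comp hg
  have hu := CompactSpace.uniformContinuous_of_continuous hg'
  have : ∃ ε > 0, ∀ a b : X, dist a b < ε → g a = g b := by
    obtain ⟨ε, he, h⟩ := Metric.uniformContinuous_iff.1 hu 1 one_pos
    refine ⟨ε, he, fun a b hab => ?_⟩
    have := h hab
    cases h1 : g a <;> cases h2 : g b <;> simp [h1, h2] at this ⊢
  obtain ⟨ε, he, h⟩ := this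
  obtain ⟨k, hk⟩ := exists_pow_lt_of_lt_one he (by norm_num : (1 / 2 : ℝ) < 1)
  exact D.const_of_step k (fun a b hab => h a b (hab.trans_lt hk)) x y

theorem cell_preconn [CompactSpace X] (i : Fin (m + 3)) : IsPreconnected (Set.range (D.f i)) := by
  haveI := D.preconn
  exact isPreconnected_range (D.f_continuous i)

/-- union of the cells with index in a set -/
def cells (s : Set (Fin (m + 3))) : Set X := {x | ∃ i ∈ s, ∃ y, D.f i y = x}

theorem cells_eq (s : Set (Fin (m + 3))) : D.cells s = ⋃ i ∈ s, Set.range (D.f i) := by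
  ext x; simp [cells]

theorem cells_preconn [CompactSpace X] (s : Set (Fin (m + 3))) : IsPreconnected (D.cells s) := by
  rw [cells_eq, Set.biUnion_eq_iUnion]
  by_cases hs : s.Nonempty
  · apply isPreconnected_iUnion
    · refine ⟨D.c, ?_⟩
      simp only [Set.mem_iInter]
      exact fun i => ⟨D.e0, D.f_e0 _⟩
    · exact fun i => D.cell_preconn _
  · rw [Set.not_nonempty_iff_eq_empty] at hs
    subst hs; simp [isPreconnected_empty]

theorem cells_closed [CompactSpace X] (s : Set (Fin (m + 3))) : IsClosed (D.cells s) := by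
  rw [cells_eq]
  exact (Set.toFinite s).isClosed_biUnion fun i _ => (D.f_closedEmb i).isClosed_range

theorem mem_cells {s : Set (Fin (m + 3))} {i : Fin (m + 3)} (hi : i ∈ s) (x : X) : D.f i x ∈ D.cells s :=
  ⟨i, hi, x, rfl⟩

theorem c_mem_cells {s : Set (Fin (m + 3))} {i : Fin (m + 3)} (hi : i ∈ s) : D.c ∈ D.cells s :=
  ⟨i, hi, _, D.f_e0 i⟩

/-! homeomorphisms -/

/-- build a homeomorphism from maps on cells -/
def mkH {Y : Type} [TopologicalSpace Y] (u v : Y → Y) (hu : Continuous u) (hv : Continuous v)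
    (h1 : ∀ x, v (u x) = x) (h2 : ∀ x, u (v x) = x) : Y ≃ₜ Y where
  toFun := u
  invFun := v
  left_inv := h1
  right_inv := h2
  continuous_toFun := hu
  continuous_invFun := hv

theorem perm_compat (p : Equiv.Perm (Fin (m + 3))) :
    ∀ i j, D.f (p i) D.e0 = D.f (p j) D.e0 := fun i j => by rw [D.f_e0, D.f_e0]

/-- permutation of the cells -/
noncomputable def perm [CompactSpace X] (p : Equiv.Perm (Fin (m + 3))) : X ≃ₜ X :=
  mkH (D.glue fun i => D.f (p i)) (D.glue fun i => D.f (p⁻¹ i))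
    (D.glue_continuous (D.perm_compat p) fun i => D.f_continuous _)
    (D.glue_continuous (D.perm_compat p⁻¹) fun i => D.f_continuous _)
    (D.ext_f fun i x => by rw [D.glue_f (D.perm_compat p), D.glue_f (D.perm_compat p⁻¹)]; simp)
    (D.ext_f fun i x => by rw [D.glue_f (D.perm_compat p⁻¹), D.glue_f (D.perm_compat p)]; simp)

theorem perm_f [CompactSpace X] (p : Equiv.Perm (Fin (m + 3))) (i : Fin (m + 3)) (x : X) :
    D.perm p (D.f i x) = D.f (p i) x := D.glue_f (D.perm_compat p) i x

theorem perm_c [CompactSpace X] (p : Equiv.Perm (Fin (m + 3))) : D.perm p D.c = D.c := by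
  rw [← D.f_e0 0, perm_f, f_e0, f_e0]

theorem perm_mul [CompactSpace X] (p q : Equiv.Perm (Fin (m + 3))) :
    D.perm (p * q) = D.perm p * D.perm q := by
  apply Homeomorph.ext
  apply D.ext_f
  intro i x
  change _ = D.perm p (D.perm q _)
  simp [perm_f]

theorem perm_one [CompactSpace X] : D.perm 1 = 1 := by
  apply Homeomorph.ext
  apply D.ext_f
  intro i x
  change _ = D.f i x
  simp [perm_f]

theorem perm_dist [CompactSpace X] (p : Equiv.Perm (Fin (m + 3))) (x y : X) :
    dist (D.perm p x) (D.perm p y) = dist x y := by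
  obtain ⟨i, x, rfl⟩ := D.cover x
  obtain ⟨j, y, rfl⟩ := D.cover y
  by_cases h : i = j
  · subst h; rw [perm_f, perm_f, D.dist_same, D.dist_same]
  · rw [perm_f, perm_f, D.dist_ne _ _ _ _ h, D.dist_ne _ _ _ _ (fun h' => h (p.injective h'))]

theorem perm_e0 [CompactSpace X] {p : Equiv.Perm (Fin (m + 3))} (hp : p 0 = 0) : D.perm p D.e0 = D.e0 := by
  conv_lhs => rw [← D.f0e1]
  rw [perm_f, hp, D.f0e1]

/-- the flip -/
noncomputable def sg [CompactSpace X] : X ≃ₜ X := D.perm (Equiv.swap 0 1)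

theorem sg_f0 [CompactSpace X] (x : X) : D.sg (D.f 0 x) = D.f 1 x := by simp [sg, perm_f]
theorem sg_f1 [CompactSpace X] (x : X) : D.sg (D.f 1 x) = D.f 0 x := by simp [sg, perm_f]
theorem sg_f [CompactSpace X] {i : Fin (m + 3)} (h0 : i ≠ 0) (h1 : i ≠ 1) (x : X) :
    D.sg (D.f i x) = D.f i x := by simp [sg, perm_f, Equiv.swap_apply_of_ne_of_ne h0 h1]
theorem sg_sg [CompactSpace X] (x : X) : D.sg (D.sg x) = x := by
  have : D.sg * D.sg = 1 := by rw [sg, ← perm_mul, Equiv.swap_mul_self, perm_one]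
  exact congrArg (fun h : X ≃ₜ X => h x) this
theorem sg_e0 [CompactSpace X] : D.sg D.e0 = D.e1 := by
  conv_lhs => rw [← D.f0e1]
  rw [sg_f0, D.f1e1]
theorem sg_e1 [CompactSpace X] : D.sg D.e1 = D.e0 := by rw [← sg_e0, sg_sg]
theorem sg_c [CompactSpace X] : D.sg D.c = D.c := D.perm_c _

/-- complement of an end is connected, auxiliary form -/
theorem conn_aux [CompactSpace X] (k : ℕ) : ∀ x, (1 / 2 : ℝ) ^ k < dist D.e0 x →
    ∃ S, IsPreconnected S ∧ x ∈ S ∧ D.e1 ∈ S ∧ D.e0 ∉ S := by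
  have hc0 : D.e0 ∉ D.cells {0}ᶜ := by
    rintro ⟨i, hi, y, h⟩
    exact D.f_ne_e0 hi y h
  have h1 : D.e1 ∈ D.cells {0}ᶜ := by
    rw [← D.f1e1]; exact D.mem_cells (by simp) _
  induction k with
  | zero => intro x hx; have := D.dist_le D.e0 x; simp at hx; linarith
  | succ k ih =>
    intro x hx
    obtain ⟨i, y, rfl⟩ := D.cover x
    by_cases hi : i = 0
    · subst hi
      obtain ⟨S, hS, hy, hS1, hS0⟩ := ih (D.sg y) (by
        rw [← D.sg_e1, sg, perm_dist]
        have h2 := D.dist_same 0 D.e1 y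
        rw [D.f0e1] at h2
        rw [h2, pow_succ] at hx; linarith)
      refine ⟨D.f 0 '' (D.sg '' S) ∪ D.cells {0}ᶜ, ?_, ?_, Or.inr h1, ?_⟩
      · apply IsPreconnected.union D.c
        · refine ⟨D.e0, ⟨D.e1, hS1, D.sg_e1⟩, D.f_e0 0⟩
        · exact D.c_mem_cells (i := 1) (by simp)
        · exact ((hS.image _ D.sg.continuous.continuousOn).image _ (D.f_continuous 0).continuousOn)
        · exact D.cells_preconn _
      · exact Or.inl ⟨y, ⟨_, hy, D.sg_sg y⟩, rfl⟩
      · rintro (⟨_, ⟨z, hz, rfl⟩, h⟩ | h)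
        · rw [← D.f0e1] at h
          have := D.f_inj 0 h
          rw [← D.sg_e0] at this
          rw [D.sg.injective this] at hz
          exact hS0 hz
        · exact hc0 h
    · exact ⟨_, D.cells_preconn {0}ᶜ, D.mem_cells hi _, h1, hc0⟩

theorem compl_e0_preconn [CompactSpace X] : IsPreconnected ({D.e0}ᶜ : Set X) := by
  apply isPreconnected_of_forall D.e1
  intro y hy
  have hpos : 0 < dist D.e0 y := dist_pos.2 (fun h => hy h.symm)
  obtain ⟨k, hk⟩ := exists_pow_lt_of_lt_one hpos (by norm_num : (1 / 2 : ℝ) < 1)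
  obtain ⟨S, hS, h1, h2, h3⟩ := D.conn_aux k y hk
  exact ⟨S, fun z hz h => h3 (h ▸ hz), h2, h1, hS⟩

/-! words -/

/-- the map of a word -/
def fw : List (Fin (m + 3)) → X → X
  | [], x => x
  | i :: w, x => D.f i (fw w x)

theorem fw_snoc (w : List (Fin (m + 3))) (i : Fin (m + 3)) (x : X) :
    D.fw (w ++ [i]) x = D.fw w (D.f i x) := by
  induction w with
  | nil => rfl
  | cons j w ih => simp only [List.cons_append, fw, ih]

theorem fw_inj (w : List (Fin (m + 3))) : Function.Injective (D.fw w) := by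
  induction w with
  | nil => exact fun _ _ h => h
  | cons j w ih => exact fun _ _ h => ih (D.f_inj j h)

theorem fw_continuous (w : List (Fin (m + 3))) : Continuous (D.fw w) := by
  induction w with
  | nil => exact continuous_id
  | cons j w ih => exact (D.f_continuous j).comp ih

theorem fw_dist (w : List (Fin (m + 3))) (x y : X) :
    dist (D.fw w x) (D.fw w y) = dist x y * (1 / 2) ^ w.length := by
  induction w with
  | nil => simp [fw]
  | cons j w ih => rw [fw, fw, D.dist_same, ih, List.length_cons, pow_succ]; ring

theorem fw_cover (k : ℕ) : ∀ x, ∃ w y, w.length = k ∧ x = D.fw w y := by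
  induction k with
  | zero => exact fun x => ⟨[], x, rfl, rfl⟩
  | succ k ih =>
    intro x
    obtain ⟨i, y, rfl⟩ := D.cover x
    obtain ⟨w, z, h, rfl⟩ := ih y
    exact ⟨i :: w, z, by simp [h], rfl⟩

/-- branch points of level at most k -/
def lev (k : ℕ) : Set X := {p | ∃ w : List (Fin (m + 3)), w.length ≤ k ∧ p = D.fw w D.c}

/-- branch points -/
def B : Set X := {p | ∃ w : List (Fin (m + 3)), p = D.fw w D.c}

theorem c_lev (k : ℕ) : D.c ∈ D.lev k := ⟨[], by simp, rfl⟩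
theorem f_lev {k : ℕ} {p : X} (i : Fin (m + 3)) (hp : p ∈ D.lev k) : D.f i p ∈ D.lev (k + 1) := by
  obtain ⟨w, hw, rfl⟩ := hp
  exact ⟨i :: w, by simpa using hw, rfl⟩
theorem lev_cases {k : ℕ} {p : X} (hp : p ∈ D.lev k) :
    p = D.c ∨ ∃ i q k', k = k' + 1 ∧ q ∈ D.lev k' ∧ p = D.f i q := by
  obtain ⟨w, hw, rfl⟩ := hp
  cases w with
  | nil => exact Or.inl rfl
  | cons i w =>
    cases k with
    | zero => simp at hw
    | succ k => exact Or.inr ⟨i, _, k, rfl, ⟨w, by simpa using hw, rfl⟩, rfl⟩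
theorem lev_mono {k l : ℕ} (h : k ≤ l) : D.lev k ⊆ D.lev l := by
  rintro _ ⟨w, hw, rfl⟩; exact ⟨w, hw.trans h, rfl⟩
theorem B_iff {p : X} : p ∈ D.B ↔ ∃ k, p ∈ D.lev k :=
  ⟨fun ⟨w, h⟩ => ⟨w.length, w, le_rfl, h⟩, fun ⟨_, w, _, h⟩ => ⟨w, h⟩⟩
theorem c_B : D.c ∈ D.B := ⟨[], rfl⟩
theorem f_B {p : X} (i : Fin (m + 3)) (hp : p ∈ D.B) : D.f i p ∈ D.B := by
  obtain ⟨w, rfl⟩ := hp; exact ⟨i :: w, rfl⟩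
theorem fw_c_B (w : List (Fin (m + 3))) : D.fw w D.c ∈ D.B := ⟨w, rfl⟩

theorem sg_lev [CompactSpace X] {k : ℕ} {p : X} (hp : p ∈ D.lev k) : D.sg p ∈ D.lev k := by
  rcases D.lev_cases hp with rfl | ⟨i, q, k, rfl, hq, rfl⟩
  · rw [sg_c]; exact D.c_lev _
  · rw [sg, perm_f]; exact D.f_lev _ hq

end Dend

namespace Dend

theorem mul_app {Y : Type} [TopologicalSpace Y] (g h : Y ≃ₜ Y) (x : Y) : (g * h) x = g (h x) := rfl
theorem one_app {Y : Type} [TopologicalSpace Y] (x : Y) : (1 : Y ≃ₜ Y) x = x := rfl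
theorem inv_app_self {Y : Type} [TopologicalSpace Y] (g : Y ≃ₜ Y) (x : Y) : g⁻¹ (g x) = x :=
  g.symm_apply_apply x
theorem app_inv_self {Y : Type} [TopologicalSpace Y] (g : Y ≃ₜ Y) (x : Y) : g (g⁻¹ x) = x :=
  g.apply_symm_apply x

variable {m : ℕ} {X : Type} [MetricSpace X] [CompactSpace X] (D : Dend m X)

/-- local data of a localized map -/
def locf (i : Fin (m + 3)) (h : X ≃ₜ X) (j : Fin (m + 3)) (x : X) : X :=
  if j = i then D.f j (h x) else D.f j x

theorem locf_compat (i : Fin (m + 3)) {h : X ≃ₜ X} (hh : h D.e0 = D.e0) :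
    ∀ j k, D.locf i h j D.e0 = D.locf i h k D.e0 := by
  intro j k
  simp only [locf, hh, f_e0, ite_self]

theorem locf_cont (i : Fin (m + 3)) (h : X ≃ₜ X) (j : Fin (m + 3)) : Continuous (D.locf i h j) := by
  unfold locf
  split_ifs
  · exact (D.f_continuous j).comp h.continuous
  · exact D.f_continuous j

theorem inv_e0 {h : X ≃ₜ X} (hh : h D.e0 = D.e0) : h⁻¹ D.e0 = D.e0 := by
  conv_lhs => rw [← hh]
  exact inv_app_self h _

theorem loc_aux (i : Fin (m + 3)) (h k : X ≃ₜ X) (hh : h D.e0 = D.e0) (hk : k D.e0 = D.e0)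
    (hkh : ∀ x, k (h x) = x) (x : X) :
    D.glue (D.locf i k) (D.glue (D.locf i h) x) = x := by
  revert x
  apply D.ext_f
  intro j x
  rw [D.glue_f (D.locf_compat i hh)]
  by_cases hj : j = i
  · subst hj
    simp only [locf, if_true]
    rw [D.glue_f (D.locf_compat j hk)]
    simp [locf, hkh]
  · simp only [locf, if_neg hj]
    rw [D.glue_f (D.locf_compat i hk)]
    simp [locf, hj]

open Classical in
/-- localization of a homeomorphism to a cell -/
noncomputable def loc (i : Fin (m + 3)) (h : X ≃ₜ X) : X ≃ₜ X :=
  if hh : h D.e0 = D.e0 then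
    mkH (D.glue (D.locf i h)) (D.glue (D.locf i h⁻¹))
      (D.glue_continuous (D.locf_compat i hh) (D.locf_cont i h))
      (D.glue_continuous (D.locf_compat i (D.inv_e0 hh)) (D.locf_cont i h⁻¹))
      (D.loc_aux i h h⁻¹ hh (D.inv_e0 hh) (inv_app_self h))
      (D.loc_aux i h⁻¹ h (D.inv_e0 hh) hh (app_inv_self h))
  else 1

theorem loc_same (i : Fin (m + 3)) {h : X ≃ₜ X} (hh : h D.e0 = D.e0) (x : X) :
    D.loc i h (D.f i x) = D.f i (h x) := by
  rw [loc, dif_pos hh]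
  change D.glue (D.locf i h) (D.f i x) = _
  rw [D.glue_f (D.locf_compat i hh)]
  simp [locf]

theorem loc_ne {i j : Fin (m + 3)} (hj : j ≠ i) (h : X ≃ₜ X) (x : X) :
    D.loc i h (D.f j x) = D.f j x := by
  unfold loc
  split_ifs with hh
  · change D.glue (D.locf i h) (D.f j x) = _
    rw [D.glue_f (D.locf_compat i hh)]
    simp [locf, hj]
  · rfl

theorem loc_e0 {i : Fin (m + 3)} (hi : i ≠ 0) (h : X ≃ₜ X) : D.loc i h D.e0 = D.e0 := by
  conv_lhs => rw [← D.f0e1]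
  rw [D.loc_ne (Ne.symm hi), D.f0e1]

theorem exists_ne (i : Fin (m + 3)) : ∃ j, j ≠ i := by
  by_cases h : i = 0
  · exact ⟨1, by subst h; simp⟩
  · exact ⟨0, Ne.symm h⟩

theorem loc_c (i : Fin (m + 3)) (h : X ≃ₜ X) : D.loc i h D.c = D.c := by
  obtain ⟨j, hj⟩ := exists_ne i
  rw [← D.f_e0 j, D.loc_ne hj]

theorem loc_mul (i : Fin (m + 3)) {g h : X ≃ₜ X} (hg : g D.e0 = D.e0) (hh : h D.e0 = D.e0) :
    D.loc i (g * h) = D.loc i g * D.loc i h := by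
  apply Homeomorph.ext
  apply D.ext_f
  intro j x
  have hgh : (g * h) D.e0 = D.e0 := by rw [mul_app, hh, hg]
  rw [mul_app]
  by_cases hj : j = i
  · subst hj; rw [D.loc_same _ hgh, D.loc_same _ hh, D.loc_same _ hg, mul_app]
  · rw [D.loc_ne hj, D.loc_ne hj, D.loc_ne hj]

theorem loc_one (i : Fin (m + 3)) : D.loc i 1 = 1 := by
  apply Homeomorph.ext
  apply D.ext_f
  intro j x
  rw [one_app]
  by_cases hj : j = i
  · subst hj; rw [D.loc_same _ rfl, one_app]
  · rw [D.loc_ne hj]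

theorem loc_inv (i : Fin (m + 3)) {h : X ≃ₜ X} (hh : h D.e0 = D.e0) :
    D.loc i h⁻¹ = (D.loc i h)⁻¹ := by
  rw [eq_inv_iff_mul_eq_one, ← D.loc_mul i (D.inv_e0 hh) hh, inv_mul_cancel, loc_one]

theorem perm_loc (p : Equiv.Perm (Fin (m + 3))) (i : Fin (m + 3)) {h : X ≃ₜ X} (hh : h D.e0 = D.e0) :
    D.perm p * D.loc i h = D.loc (p i) h * D.perm p := by
  apply Homeomorph.ext
  apply D.ext_f
  intro j x
  rw [mul_app, mul_app, perm_f]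
  by_cases hj : j = i
  · subst hj; rw [D.loc_same _ hh, D.loc_same _ hh, perm_f]
  · rw [D.loc_ne hj, D.loc_ne (fun h' => hj (p.injective h')), perm_f]

/-! the edge flip -/

/-- inner data of the edge flip -/
noncomputable def tin (j : Fin (m + 3)) (x : X) : X := if j = 0 then D.f 0 (D.f 0 (D.sg x)) else D.f j x

theorem tin_compat : ∀ i j, D.tin i D.e0 = D.tin j D.e0 := by
  intro i j
  simp only [tin, sg_e0, D.f0e1, f_e0, ite_self]

theorem tin_cont (j : Fin (m + 3)) : Continuous (D.tin j) := by
  unfold tin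
  split_ifs
  · exact (D.f_continuous 0).comp ((D.f_continuous 0).comp D.sg.continuous)
  · exact D.f_continuous j

/-- outer data of the edge flip -/
noncomputable def tout (j : Fin (m + 3)) (x : X) : X := if j = 0 then D.glue D.tin x else D.f 0 (D.f j x)

theorem tout_compat : ∀ i j, D.tout i D.e0 = D.tout j D.e0 := by
  have : D.glue D.tin D.e0 = D.f 0 D.c := by
    conv_lhs => rw [← D.f0e1]
    rw [D.glue_f D.tin_compat]
    simp only [tin, if_true, sg_e1, f_e0]
  intro i j
  simp only [tout, this, f_e0, ite_self]

theorem tout_cont (j : Fin (m + 3)) : Continuous (D.tout j) := by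
  unfold tout
  split_ifs
  · exact D.glue_continuous D.tin_compat D.tin_cont
  · exact (D.f_continuous 0).comp (D.f_continuous j)

theorem tm_f {j : Fin (m + 3)} (hj : j ≠ 0) (x : X) : D.glue D.tout (D.f j x) = D.f 0 (D.f j x) := by
  rw [D.glue_f D.tout_compat]; simp [tout, hj]
theorem tm_f0f {j : Fin (m + 3)} (hj : j ≠ 0) (x : X) : D.glue D.tout (D.f 0 (D.f j x)) = D.f j x := by
  rw [D.glue_f D.tout_compat]; simp only [tout, if_true]
  rw [D.glue_f D.tin_compat]; simp [tin, hj]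
theorem tm_f0f0 (x : X) : D.glue D.tout (D.f 0 (D.f 0 x)) = D.f 0 (D.f 0 (D.sg x)) := by
  rw [D.glue_f D.tout_compat]; simp only [tout, if_true]
  rw [D.glue_f D.tin_compat]; simp [tin]

theorem tm_tm (x : X) : D.glue D.tout (D.glue D.tout x) = x := by
  revert x
  apply D.ext_f
  intro i x
  by_cases hi : i = 0
  · subst hi
    revert x
    apply D.ext_f
    intro i x
    by_cases hi : i = 0
    · subst hi; rw [tm_f0f0, tm_f0f0, sg_sg]
    · rw [D.tm_f0f hi, D.tm_f hi]
  · rw [D.tm_f hi, D.tm_f0f hi]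

/-- the edge flip -/
noncomputable def t : X ≃ₜ X :=
  mkH (D.glue D.tout) (D.glue D.tout) (D.glue_continuous D.tout_compat D.tout_cont)
    (D.glue_continuous D.tout_compat D.tout_cont) D.tm_tm D.tm_tm

theorem t_f {j : Fin (m + 3)} (hj : j ≠ 0) (x : X) : D.t (D.f j x) = D.f 0 (D.f j x) := D.tm_f hj x
theorem t_f0f {j : Fin (m + 3)} (hj : j ≠ 0) (x : X) : D.t (D.f 0 (D.f j x)) = D.f j x := D.tm_f0f hj x
theorem t_f0f0 (x : X) : D.t (D.f 0 (D.f 0 x)) = D.f 0 (D.f 0 (D.sg x)) := D.tm_f0f0 x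
theorem t_mul_t : D.t * D.t = 1 := Homeomorph.ext D.tm_tm

theorem t_loc {j : Fin (m + 3)} (hj : j ≠ 0) {h : X ≃ₜ X} (hh : h D.e0 = D.e0) :
    D.t * D.loc j h = D.loc 0 (D.loc j h) * D.t := by
  have hl := D.loc_e0 hj h
  apply Homeomorph.ext
  apply D.ext_f
  intro i x
  rw [mul_app, mul_app]
  by_cases hi : i = 0
  · subst hi
    rw [D.loc_ne (Ne.symm hj)]
    revert x
    apply D.ext_f
    intro i x
    by_cases hi : i = 0
    · subst hi; rw [t_f0f0, D.loc_same 0 hl, D.loc_ne (Ne.symm hj)]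
    · rw [D.t_f0f hi, D.loc_ne hi]
  · rw [D.t_f hi, D.loc_same 0 hl]
    by_cases hij : i = j
    · subst hij; rw [D.loc_same i hh, D.t_f hi]
    · rw [D.loc_ne hij, D.t_f hi]

/-- the translation along the arc -/
noncomputable def x : X ≃ₜ X := D.t * D.sg

theorem one_ne_zero' : (1 : Fin (m + 3)) ≠ 0 := by simp
theorem two_ne_zero' : (2 : Fin (m + 3)) ≠ 0 := by
  intro h; simpa [Fin.ext_iff, Nat.mod_eq_of_lt (show 2 < m + 3 by omega)] using congrArg Fin.val h
theorem two_ne_one' : (2 : Fin (m + 3)) ≠ 1 := by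
  intro h
  have := congrArg Fin.val h
  simp [Nat.mod_eq_of_lt (show 2 < m + 3 by omega)] at this

theorem x_f0 (y : X) : D.x (D.f 0 y) = D.f 0 (D.f 1 y) := by
  rw [x, mul_app, sg_f0, D.t_f one_ne_zero']
theorem x_f {j : Fin (m + 3)} (h0 : j ≠ 0) (h1 : j ≠ 1) (y : X) : D.x (D.f j y) = D.f 0 (D.f j y) := by
  rw [x, mul_app, D.sg_f h0 h1, D.t_f h0]
theorem x_f1f {j : Fin (m + 3)} (h0 : j ≠ 0) (y : X) : D.x (D.f 1 (D.f j y)) = D.f j y := by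
  rw [x, mul_app, D.sg_f1, D.t_f0f h0]
theorem x_f1f0 (y : X) : D.x (D.f 1 (D.f 0 y)) = D.f 0 (D.f 0 (D.sg y)) := by
  rw [x, mul_app, D.sg_f1, D.t_f0f0]
theorem x_c : D.x D.c = D.f 0 D.c := by
  conv_lhs => rw [← D.f_e0 2]
  rw [D.x_f two_ne_zero' two_ne_one', f_e0]
theorem x_f1c : D.x (D.f 1 D.c) = D.c := by
  conv_lhs => rw [← D.f_e0 2]
  rw [D.x_f1f two_ne_zero', f_e0]
theorem x_e0 : D.x D.e0 = D.e0 := by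
  conv_lhs => rw [← D.f0e1]
  rw [x_f0, D.f1e1, D.f0e1]

theorem x_loc {j : Fin (m + 3)} (hj : j ≠ 0) {h : X ≃ₜ X} (hh : h D.e0 = D.e0) :
    D.x * D.loc 1 (D.loc j h) = D.loc j h * D.x := by
  have hl := D.loc_e0 hj h
  apply Homeomorph.ext
  apply D.ext_f
  intro i y
  rw [mul_app, mul_app]
  by_cases hi : i = 0
  · subst hi
    rw [D.loc_ne (by simp), x_f0, D.loc_ne (Ne.symm hj)]
  by_cases hi1 : i = 1
  · subst hi1
    rw [D.loc_same 1 hl]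
    revert y
    apply D.ext_f
    intro i y
    by_cases hi : i = 0
    · subst hi; rw [D.loc_ne (Ne.symm hj), x_f1f0, D.loc_ne (Ne.symm hj)]
    · rw [D.x_f1f hi]
      by_cases hij : i = j
      · subst hij; rw [D.loc_same i hh, D.x_f1f hi]
      · rw [D.loc_ne hij, D.x_f1f hi]
  · rw [D.loc_ne hi1, D.x_f hi hi1, D.loc_ne (Ne.symm hj)]

theorem x_lev {k : ℕ} {p : X} (hp : p ∈ D.lev k) : D.x p ∈ D.lev (k + 1) := by
  rcases D.lev_cases hp with rfl | ⟨i, q, k, rfl, hq, rfl⟩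
  · rw [x_c]; exact D.lev_mono (by omega) (D.f_lev 0 (D.c_lev 0))
  by_cases hi : i = 0
  · subst hi; rw [x_f0]; exact D.f_lev _ (D.f_lev _ hq)
  by_cases hi1 : i = 1
  · subst hi1
    rcases D.lev_cases hq with rfl | ⟨i, q', k', rfl, hq', rfl⟩
    · rw [x_f1c]; exact D.c_lev _
    by_cases hi : i = 0
    · subst hi; rw [x_f1f0]
      exact D.lev_mono (k := k' + 1 + 1) (by omega) (D.f_lev _ (D.f_lev _ (D.sg_lev hq')))
    · rw [D.x_f1f hi]; exact D.lev_mono (k := k' + 1) (by omega) (D.f_lev _ hq')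
  · rw [D.x_f hi hi1]; exact D.f_lev _ (D.f_lev _ hq)

/-! the group -/

/-- first exotic involution -/
noncomputable def u : X ≃ₜ X := D.loc 1 D.x * D.perm (Equiv.swap 1 2) * D.loc 1 D.x⁻¹
/-- second exotic involution -/
noncomputable def v : X ≃ₜ X := D.loc 2 D.x * D.t * D.loc 2 D.x⁻¹

/-- the generators -/
noncomputable def gens : Set (X ≃ₜ X) :=
  Set.range D.perm ∪ {D.t, D.u, D.v} ∪ (fun p => D.loc 1 (D.perm p)) '' {p | p 0 = 0}

/-- the group -/
noncomputable def G : Subgroup (X ≃ₜ X) := Subgroup.closure D.gens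

theorem gens_finite : D.gens.Finite := by
  unfold gens
  exact ((Set.finite_range _).union (Set.toFinite _)).union (Set.toFinite _)

theorem conj_sq {H : Type} [Group H] {a b : H} (h : b * b = 1) : (a * b * a⁻¹) * (a * b * a⁻¹) = 1 := by
  rw [show (a * b * a⁻¹) * (a * b * a⁻¹) = a * (b * b) * a⁻¹ by group, h]; group

theorem gens_fin_order {g : X ≃ₜ X} (hg : g ∈ D.gens) : IsOfFinOrder g := by
  have hp : ∀ p, IsOfFinOrder (D.perm p) := by
    intro p
    exact MonoidHom.isOfFinOrder (⟨⟨D.perm, D.perm_one⟩, D.perm_mul⟩ : Equiv.Perm (Fin (m + 3)) →* (X ≃ₜ X))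
      (isOfFinOrder_of_finite p)
  have hsq : ∀ h : X ≃ₜ X, h * h = 1 → IsOfFinOrder h := fun h hh =>
    isOfFinOrder_iff_pow_eq_one.2 ⟨2, by norm_num, by rw [pow_two, hh]⟩
  rcases hg with (⟨p, rfl⟩ | rfl | rfl | rfl) | ⟨p, hp0, rfl⟩
  · exact hp p
  · exact hsq _ D.t_mul_t
  · apply hsq
    rw [u, D.loc_inv 1 D.x_e0]
    apply conj_sq
    rw [← perm_mul, Equiv.swap_mul_self, perm_one]
  · apply hsq
    rw [v, D.loc_inv 2 D.x_e0]
    exact conj_sq D.t_mul_t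
  · obtain ⟨k, hk, h⟩ := isOfFinOrder_iff_pow_eq_one.1 (isOfFinOrder_of_finite p)
    refine isOfFinOrder_iff_pow_eq_one.2 ⟨k, hk, ?_⟩
    have hpow : ∀ k : ℕ, (D.loc 1 (D.perm p)) ^ k = D.loc 1 (D.perm (p ^ k)) ∧ (p ^ k) 0 = 0 := by
      intro k
      induction k with
      | zero => simp [perm_one, loc_one]
      | succ k ih =>
        have h1 : (p ^ (k + 1)) 0 = 0 := by
          rw [pow_succ, Equiv.Perm.mul_apply, hp0, ih.2]
        refine ⟨?_, h1⟩
        rw [pow_succ, ih.1, pow_succ, perm_mul, D.loc_mul 1 (D.perm_e0 ih.2) (D.perm_e0 hp0)]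
    change (D.loc 1 (D.perm p)) ^ k = 1
    rw [(hpow k).1, h, perm_one, loc_one]

theorem perm_G (p : Equiv.Perm (Fin (m + 3))) : D.perm p ∈ D.G :=
  Subgroup.subset_closure (Or.inl (Or.inl ⟨p, rfl⟩))
theorem t_G : D.t ∈ D.G := Subgroup.subset_closure (Or.inl (Or.inr (Or.inl rfl)))
theorem u_G : D.u ∈ D.G := Subgroup.subset_closure (Or.inl (Or.inr (Or.inr (Or.inl rfl))))
theorem v_G : D.v ∈ D.G := Subgroup.subset_closure (Or.inl (Or.inr (Or.inr (Or.inr rfl))))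
theorem x_G : D.x ∈ D.G := D.G.mul_mem D.t_G (D.perm_G _)

/-- homeomorphisms whose localizations are in G -/
def K : Set (X ≃ₜ X) := {k | k D.e0 = D.e0 ∧ D.loc 1 k ∈ D.G}

theorem K_mul {g h : X ≃ₜ X} (hg : g ∈ D.K) (hh : h ∈ D.K) : g * h ∈ D.K :=
  ⟨by rw [mul_app, hh.1, hg.1], by rw [D.loc_mul 1 hg.1 hh.1]; exact D.G.mul_mem hg.2 hh.2⟩
theorem K_inv {g : X ≃ₜ X} (hg : g ∈ D.K) : g⁻¹ ∈ D.K :=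
  ⟨D.inv_e0 hg.1, by rw [D.loc_inv 1 hg.1]; exact D.G.inv_mem hg.2⟩
theorem K_perm {p : Equiv.Perm (Fin (m + 3))} (hp : p 0 = 0) : D.perm p ∈ D.K :=
  ⟨D.perm_e0 hp, Subgroup.subset_closure (Or.inr ⟨p, hp, rfl⟩)⟩
theorem K_loc {k : X ≃ₜ X} (hk : k ∈ D.K) (i : Fin (m + 3)) : D.loc i k ∈ D.G := by
  have h := D.perm_loc (Equiv.swap 1 i) 1 hk.1
  rw [Equiv.swap_apply_left] at h
  rw [eq_mul_inv_of_mul_eq h.symm]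
  exact D.G.mul_mem (D.G.mul_mem (D.perm_G _) hk.2) (D.G.inv_mem (D.perm_G _))

/-- first translation -/
noncomputable def ka : X ≃ₜ X := D.x * D.loc 2 D.x⁻¹
/-- second translation -/
noncomputable def kb : X ≃ₜ X := D.loc 1 D.x * D.loc 2 D.x⁻¹

theorem kb_G : D.kb ∈ D.G := by
  have h := D.perm_loc (Equiv.swap 1 2) 1 (D.inv_e0 D.x_e0)
  rw [Equiv.swap_apply_left] at h
  have h2 : D.u = D.kb * D.perm (Equiv.swap 1 2) := by
    rw [u, kb, mul_assoc, h, mul_assoc]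
  rw [eq_mul_inv_of_mul_eq h2.symm]
  exact D.G.mul_mem D.u_G (D.G.inv_mem (D.perm_G _))

theorem kb_K : D.kb ∈ D.K := by
  have h1 := D.loc_e0 one_ne_zero' D.x
  have h2 := D.loc_e0 two_ne_zero' D.x⁻¹
  refine ⟨by rw [kb, mul_app, h2, h1], ?_⟩
  have h : D.x * D.loc 1 D.kb = D.kb * D.x := by
    rw [kb, D.loc_mul 1 h1 h2, ← mul_assoc, D.x_loc one_ne_zero' D.x_e0, mul_assoc,
      D.x_loc two_ne_zero' (D.inv_e0 D.x_e0), mul_assoc]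
  rw [eq_inv_mul_of_mul_eq h]
  exact D.G.mul_mem (D.G.inv_mem D.x_G) (D.G.mul_mem D.kb_G D.x_G)

theorem ka_K : D.ka ∈ D.K := by
  have h2 := D.loc_e0 two_ne_zero' D.x⁻¹
  refine ⟨by rw [ka, mul_app, h2, x_e0], ?_⟩
  have e1 : D.v * D.t = D.loc 2 D.x * D.loc 0 (D.loc 2 D.x⁻¹) := by
    rw [v, mul_assoc (D.loc 2 D.x), D.t_loc two_ne_zero' (D.inv_e0 D.x_e0), mul_assoc, mul_assoc, t_mul_t, mul_one]
  have s1 := D.perm_loc (Equiv.swap 0 1) 2 D.x_e0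
  rw [Equiv.swap_apply_of_ne_of_ne two_ne_zero' two_ne_one'] at s1
  have s2 := D.perm_loc (Equiv.swap 0 1) 0 h2
  rw [Equiv.swap_apply_left] at s2
  have e2 : D.sg * (D.v * D.t) = (D.loc 2 D.x * D.loc 1 (D.loc 2 D.x⁻¹)) * D.sg := by
    rw [e1, sg, ← mul_assoc, s1, mul_assoc, s2, mul_assoc]
  have e3 : D.loc 2 D.x * D.loc 1 (D.loc 2 D.x⁻¹) ∈ D.G := by
    rw [eq_mul_inv_of_mul_eq e2.symm]
    exact D.G.mul_mem (D.G.mul_mem (D.perm_G _) (D.G.mul_mem D.v_G D.t_G)) (D.G.inv_mem (D.perm_G _))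
  have e4 : D.loc 1 D.ka = D.kb * (D.loc 2 D.x * D.loc 1 (D.loc 2 D.x⁻¹)) := by
    rw [ka, D.loc_mul 1 D.x_e0 h2, kb, D.loc_inv 2 D.x_e0]; group
  rw [e4]
  exact D.G.mul_mem D.kb_G e3

/-- orbit of the centre under K -/
def Orb (p : X) : Prop := ∃ k ∈ D.K, k D.c = p

theorem Orb_fwd {p : X} {k : X ≃ₜ X} (hk : k ∈ D.K) (h : D.Orb p) : D.Orb (k p) := by
  obtain ⟨g, hg, rfl⟩ := h
  exact ⟨k * g, D.K_mul hk hg, rfl⟩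
theorem Orb_bwd {p : X} {k : X ≃ₜ X} (hk : k ∈ D.K) (h : D.Orb (k p)) : D.Orb p := by
  have := D.Orb_fwd (D.K_inv hk) h
  rwa [inv_app_self] at this
theorem Orb_c : D.Orb D.c := ⟨1, ⟨rfl, by rw [loc_one]; exact D.G.one_mem⟩, rfl⟩

theorem ka_f {i : Fin (m + 3)} (hi : i ≠ 2) (y : X) : D.ka (D.f i y) = D.x (D.f i y) := by
  rw [ka, mul_app, D.loc_ne hi]
theorem kb_f1 (y : X) : D.kb (D.f 1 y) = D.f 1 (D.x y) := by
  rw [kb, mul_app, D.loc_ne (Ne.symm two_ne_one'), D.loc_same 1 D.x_e0]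

theorem Orb_f1 {N : ℕ} (ih : ∀ p ∈ D.lev N, D.Orb p) {q : X} (hq : q ∈ D.lev N) : D.Orb (D.f 1 q) := by
  have h12 : (1 : Fin (m + 3)) ≠ 2 := Ne.symm two_ne_one'
  rcases D.lev_cases hq with rfl | ⟨j, r, N, rfl, hr, rfl⟩
  · apply D.Orb_bwd D.ka_K
    rw [D.ka_f h12, x_f1c]; exact D.Orb_c
  by_cases hj : j = 0
  swap
  · apply D.Orb_bwd D.ka_K
    rw [D.ka_f h12, D.x_f1f hj]; exact ih _ (D.f_lev _ hr)
  subst hj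
  suffices ∃ z, D.x z = D.f 0 r ∧ D.Orb (D.f 1 z) by
    obtain ⟨z, hz, ho⟩ := this
    rw [← hz, ← kb_f1]
    exact D.Orb_fwd D.kb_K ho
  rcases D.lev_cases hr with rfl | ⟨k, s, N, rfl, hs, rfl⟩
  · exact ⟨D.c, D.x_c, ih _ (D.f_lev _ (D.c_lev _))⟩
  by_cases hk0 : k = 0
  · subst hk0
    refine ⟨D.f 1 (D.f 0 (D.sg s)), by rw [x_f1f0, sg_sg], ?_⟩
    apply D.Orb_bwd D.ka_K
    rw [D.ka_f h12, D.x_f1f one_ne_zero']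
    exact ih _ (D.f_lev _ (D.f_lev _ (D.sg_lev hs)))
  by_cases hk1 : k = 1
  · subst hk1
    exact ⟨D.f 0 s, D.x_f0 s, ih _ (D.f_lev _ (D.f_lev _ hs))⟩
  · exact ⟨D.f k s, D.x_f hk0 hk1 s, ih _ (D.f_lev _ (D.f_lev _ hs))⟩

theorem Orb_fi {N : ℕ} (ih : ∀ p ∈ D.lev N, D.Orb p) {q : X} (hq : q ∈ D.lev N) {i : Fin (m + 3)}
    (hi : i ≠ 0) : D.Orb (D.f i q) := by
  have := D.Orb_fwd (D.K_perm (p := Equiv.swap 1 i)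
    (Equiv.swap_apply_of_ne_of_ne (Ne.symm one_ne_zero') (Ne.symm hi))) (D.Orb_f1 ih hq)
  rwa [perm_f, Equiv.swap_apply_left] at this

theorem Orb_f0 {N : ℕ} (ih : ∀ p ∈ D.lev N, D.Orb p) {q : X} (hq : q ∈ D.lev N) : D.Orb (D.f 0 q) := by
  have h02 : (0 : Fin (m + 3)) ≠ 2 := Ne.symm two_ne_zero'
  have h12 : (1 : Fin (m + 3)) ≠ 2 := Ne.symm two_ne_one'
  suffices ∃ z, D.ka z = D.f 0 q ∧ D.Orb z by
    obtain ⟨z, hz, ho⟩ := this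
    rw [← hz]
    exact D.Orb_fwd D.ka_K ho
  rcases D.lev_cases hq with rfl | ⟨j, r, N, rfl, hr, rfl⟩
  · exact ⟨D.c, by rw [ka, mul_app, loc_c, x_c], D.Orb_c⟩
  by_cases hj0 : j = 0
  · subst hj0
    refine ⟨D.f 1 (D.f 0 (D.sg r)), by rw [D.ka_f h12, x_f1f0, sg_sg], ?_⟩
    exact D.Orb_f1 ih (D.f_lev _ (D.sg_lev hr))
  by_cases hj1 : j = 1
  · subst hj1
    exact ⟨D.f 0 r, by rw [D.ka_f h02, x_f0], ih _ (D.f_lev _ hr)⟩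
  by_cases hj2 : j = 2
  · subst hj2
    refine ⟨D.f 2 (D.x r), ?_, D.Orb_fi ih (D.x_lev hr) two_ne_zero'⟩
    rw [ka, mul_app, D.loc_same 2 (D.inv_e0 D.x_e0), inv_app_self, D.x_f hj0 hj1]
  · exact ⟨D.f j r, by rw [D.ka_f hj2, D.x_f hj0 hj1], ih _ (D.f_lev _ hr)⟩

theorem Orb_lev (N : ℕ) : ∀ p ∈ D.lev N, D.Orb p := by
  induction N with
  | zero =>
    rintro p hp
    rcases D.lev_cases hp with rfl | ⟨j, r, N, h, _⟩
    · exact D.Orb_c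
    · omega
  | succ N ih =>
    intro p hp
    rcases D.lev_cases hp with rfl | ⟨j, r, N, h, hr, rfl⟩
    · exact D.Orb_c
    obtain rfl : N = _ := (Nat.succ_injective h).symm
    by_cases hj : j = 0
    · subst hj; exact D.Orb_f0 ih hr
    · exact D.Orb_fi ih hr hj

theorem Orb_B {p : X} (hp : p ∈ D.B) : D.Orb p := by
  obtain ⟨k, hk⟩ := D.B_iff.1 hp
  exact D.Orb_lev k p hk

theorem G_trans {p : X} (hp : p ∈ D.B) : ∃ g ∈ D.G, g D.c = p := by
  obtain ⟨k, hk⟩ := D.B_iff.1 hp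
  rcases D.lev_cases hk with rfl | ⟨j, r, N, rfl, hr, rfl⟩
  · exact ⟨1, D.G.one_mem, rfl⟩
  obtain ⟨g, hg, rfl⟩ := D.Orb_lev _ _ hr
  refine ⟨D.loc j g * (D.perm (Equiv.swap 1 j) * D.x⁻¹), D.G.mul_mem (D.K_loc hg j)
    (D.G.mul_mem (D.perm_G _) (D.G.inv_mem D.x_G)), ?_⟩
  have : D.x⁻¹ D.c = D.f 1 D.c := by
    conv_lhs => rw [← D.x_f1c]
    exact inv_app_self _ _
  rw [mul_app, mul_app, this, perm_f, Equiv.swap_apply_left, D.loc_same j hg.1]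

end Dend

namespace Dend

variable {m : ℕ} {X : Type} [MetricSpace X] [CompactSpace X] (D : Dend m X)

theorem fw_range_closed (w : List (Fin (m + 3))) : IsClosed (Set.range (D.fw w)) :=
  (isCompact_range (D.fw_continuous w)).isClosed

theorem locConn (D : Dend m X) : LocallyConnectedSpace X := by
  rw [locallyConnectedSpace_iff_connected_subsets]
  intro x U hU
  obtain ⟨ε, he, hb⟩ := Metric.mem_nhds_iff.1 hU
  obtain ⟨k, hk⟩ := exists_pow_lt_of_lt_one he (by norm_num : (1 / 2 : ℝ) < 1)
  have hfin : {w : List (Fin (m + 3)) | w.length = k}.Finite := List.finite_length_eq _ k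
  let V : Set X := ⋃ w ∈ {w : List (Fin (m + 3)) | w.length = k ∧ x ∈ Set.range (D.fw w)}, Set.range (D.fw w)
  refine ⟨V, ?_, ?_, ?_⟩
  · let W : Set X := ⋃ w ∈ {w : List (Fin (m + 3)) | w.length = k ∧ x ∉ Set.range (D.fw w)}, Set.range (D.fw w)
    have hW : IsClosed W :=
      (hfin.subset (fun w hw => hw.1)).isClosed_biUnion fun w _ => D.fw_range_closed w
    refine Filter.mem_of_superset (hW.isOpen_compl.mem_nhds (x := x) ?_) ?_
    · simp only [W, Set.mem_compl_iff, Set.mem_iUnion, not_exists]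
      intro w hw hx
      exact hw.2 hx
    · intro y hy
      obtain ⟨w, z, hw, rfl⟩ := D.fw_cover k y
      by_cases hx : x ∈ Set.range (D.fw w)
      · exact Set.mem_biUnion (⟨hw, hx⟩ : w ∈ {w : List (Fin (m + 3)) | w.length = k ∧ x ∈ Set.range (D.fw w)}) ⟨z, rfl⟩
      · exfalso
        apply hy
        exact Set.mem_biUnion (⟨hw, hx⟩ : w ∈ {w : List (Fin (m + 3)) | w.length = k ∧ x ∉ Set.range (D.fw w)}) ⟨z, rfl⟩
  · haveI := D.preconn
    apply isPreconnected_of_forall x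
    intro y hy
    simp only [V, Set.mem_iUnion] at hy
    obtain ⟨w, hw, hy⟩ := hy
    exact ⟨Set.range (D.fw w), Set.subset_biUnion_of_mem (u := fun w => Set.range (D.fw w)) hw, hw.2, hy, isPreconnected_range (D.fw_continuous w)⟩
  · intro y hy
    simp only [V, Set.mem_iUnion] at hy
    obtain ⟨w, ⟨hw, a, ha⟩, b, hb'⟩ := hy
    apply hb
    rw [Metric.mem_ball, ← ha, ← hb', fw_dist, hw]
    have := D.dist_le b a
    have h2 : (0 : ℝ) < (1 / 2) ^ k := by positivity
    nlinarith

/-- a separates b from s -/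
def Sep (a b s : X) : Prop :=
  ∃ U V : Set X, IsOpen U ∧ IsOpen V ∧ Disjoint U V ∧ U ∪ V = {a}ᶜ ∧ b ∈ U ∧ s ∈ V

theorem Sep.not_preconn {a b s : X} (h : Sep a b s) {S : Set X} (hS : IsPreconnected S) (ha : a ∉ S)
    (hb : b ∈ S) (hs : s ∈ S) : False := by
  obtain ⟨U, V, hU, hV, hd, huv, hbU, hsV⟩ := h
  have : S ⊆ U := hS.subset_left_of_subset_union hU hV hd
    (by rw [huv]; exact fun x hx h => ha (h ▸ hx)) ⟨b, hb, hbU⟩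
  exact Set.disjoint_left.1 hd (this hs) hsV

theorem Sep.ne_left {a b s : X} (h : Sep a b s) : b ≠ a := by
  obtain ⟨U, V, hU, hV, hd, huv, hbU, hsV⟩ := h
  have : b ∈ ({a}ᶜ : Set X) := huv ▸ Or.inl hbU
  exact this

theorem Sep.ne_right {a b s : X} (h : Sep a b s) : s ≠ a := by
  obtain ⟨U, V, hU, hV, hd, huv, hbU, hsV⟩ := h
  have : s ∈ ({a}ᶜ : Set X) := huv ▸ Or.inr hsV
  exact this

theorem Sep.symm {a b s : X} (h : Sep a b s) : Sep a s b := by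
  obtain ⟨U, V, hU, hV, hd, huv, hbU, hsV⟩ := h
  exact ⟨V, U, hV, hU, hd.symm, by rw [Set.union_comm, huv], hsV, hbU⟩

theorem Sep.map {a b s : X} (h : Sep a b s) (g : X ≃ₜ X) : Sep (g a) (g b) (g s) := by
  obtain ⟨U, V, hU, hV, hd, huv, hbU, hsV⟩ := h
  refine ⟨g '' U, g '' V, g.isOpenMap _ hU, g.isOpenMap _ hV,
    (Set.disjoint_image_iff g.injective).2 hd, ?_, ⟨b, hbU, rfl⟩, ⟨s, hsV, rfl⟩⟩
  rw [← Set.image_union, huv, Set.image_compl_eq g.bijective, Set.image_singleton]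

theorem Sep.lift {a : X} (i : Fin (m + 3)) {b s : X} (h : Sep a (D.r i b) (D.r i s)) (ha : a ≠ D.e0) :
    Sep (D.f i a) b s := by
  obtain ⟨U, V, hU, hV, hd, huv, hbU, hsV⟩ := h
  refine ⟨D.r i ⁻¹' U, D.r i ⁻¹' V, hU.preimage (D.r_continuous i), hV.preimage (D.r_continuous i),
    hd.preimage _, ?_, hbU, hsV⟩
  rw [← Set.preimage_union, huv]
  ext x
  simp only [Set.mem_preimage, Set.mem_compl_iff, Set.mem_singleton_iff]
  constructor
  · rintro h rfl; exact h (D.r_same i a)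
  · intro h h'; exact h (D.r_eq ha h')

theorem Sep.lift_f {a b s : X} (i : Fin (m + 3)) (h : Sep a b s) (ha : a ≠ D.e0) :
    Sep (D.f i a) (D.f i b) (D.f i s) := by
  apply Sep.lift D i _ ha
  rwa [r_same, r_same]

/-- open cell -/
def Q (i : Fin (m + 3)) : Set X := D.f i '' {D.e0}ᶜ

theorem Q_eq (i : Fin (m + 3)) : D.Q i = (D.cells {i}ᶜ)ᶜ := by
  ext x
  constructor
  · rintro ⟨y, hy, rfl⟩ ⟨j, hj, z, h⟩
    exact hy (D.f_ne hj h).2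
  · intro h
    obtain ⟨j, y, rfl⟩ := D.cover x
    by_cases hj : j = i
    · subst hj
      refine ⟨y, ?_, rfl⟩
      rintro rfl
      obtain ⟨k, hk⟩ := exists_ne j
      apply h
      rw [f_e0]; exact D.c_mem_cells (i := k) hk
    · exact absurd (D.mem_cells hj y) h

theorem Q_open (i : Fin (m + 3)) : IsOpen (D.Q i) := by
  rw [Q_eq]; exact (D.cells_closed _).isOpen_compl

theorem Q_preconn (i : Fin (m + 3)) : IsPreconnected (D.Q i) :=
  D.compl_e0_preconn.image _ (D.f_continuous i).continuousOn

theorem Q_c (i : Fin (m + 3)) : D.c ∉ D.Q i := by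
  rintro ⟨y, hy, h⟩
  exact hy (D.f_eq_c h)

theorem Q_union (i : Fin (m + 3)) : D.Q i ∪ (Set.range (D.f i))ᶜ = {D.c}ᶜ := by
  ext x
  constructor
  · rintro (⟨y, hy, rfl⟩ | h) h'
    · exact hy (D.f_eq_c h')
    · exact h ⟨D.e0, by rw [h', f_e0]⟩
  · intro h
    by_cases hx : x ∈ Set.range (D.f i)
    · obtain ⟨y, rfl⟩ := hx
      refine Or.inl ⟨y, ?_, rfl⟩
      rintro rfl
      exact h (D.f_e0 i)
    · exact Or.inr hx

theorem sep_c {i : Fin (m + 3)} {y s : X} (hy : y ≠ D.e0) (hs : s ∉ Set.range (D.f i)) :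
    Sep D.c (D.f i y) s :=
  ⟨D.Q i, (Set.range (D.f i))ᶜ, D.Q_open i, (D.f_closedEmb i).isClosed_range.isOpen_compl,
    Set.disjoint_left.2 (by rintro _ ⟨y, _, rfl⟩ h; exact h ⟨y, rfl⟩), D.Q_union i, ⟨y, hy, rfl⟩, hs⟩

theorem sep_c_ne {i j : Fin (m + 3)} (hij : i ≠ j) {y z : X} (hy : y ≠ D.e0) (hz : z ≠ D.e0) :
    Sep D.c (D.f i y) (D.f j z) :=
  D.sep_c hy (by rintro ⟨x, hx⟩; exact hz (D.f_ne hij hx).2)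

theorem B_ne {p : X} (hp : p ∈ D.B) : p ≠ D.e0 ∧ p ≠ D.e1 := by
  obtain ⟨w, rfl⟩ := hp
  induction w with
  | nil => exact ⟨D.c_ne_e0, D.c_ne_e1⟩
  | cons i w ih =>
    constructor
    · intro h
      by_cases hi : i = 0
      · subst hi
        rw [← D.f0e1] at h
        exact ih.2 (D.f_inj 0 h)
      · exact D.f_ne_e0 hi _ h
    · intro h
      rw [← D.f1e1] at h
      by_cases hi : i = 1
      · subst hi
        exact ih.2 (D.f_inj 1 h)
      · exact D.ne (D.f_ne hi h).2.symm

theorem sep_exists_aux (k : ℕ) : ∀ x y : X, (1 / 2 : ℝ) ^ k < dist x y → ∃ b ∈ D.B, Sep b x y := by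
  induction k with
  | zero => intro x y h; have := D.dist_le x y; simp at h; linarith
  | succ k ih =>
    have same : ∀ i x y, (1 / 2 : ℝ) ^ (k + 1) < dist (D.f i x) (D.f i y) →
        ∃ b ∈ D.B, Sep b (D.f i x) (D.f i y) := by
      intro i x y h
      rw [D.dist_same, pow_succ] at h
      obtain ⟨b, hb, hs⟩ := ih x y (by linarith)
      exact ⟨_, D.f_B i hb, hs.lift_f D i (D.B_ne hb).1⟩
    intro x y h
    obtain ⟨i, x, rfl⟩ := D.cover x
    obtain ⟨j, y, rfl⟩ := D.cover y
    by_cases hij : i = j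
    · subst hij; exact same _ _ _ h
    by_cases hx : x = D.e0
    · subst hx; rw [D.f_e0 i, ← D.f_e0 j] at h ⊢; exact same _ _ _ h
    by_cases hy : y = D.e0
    · subst hy; rw [D.f_e0 j, ← D.f_e0 i] at h ⊢; exact same _ _ _ h
    exact ⟨D.c, D.c_B, D.sep_c_ne hij hx hy⟩

theorem sep_exists {x y : X} (h : x ≠ y) : ∃ b ∈ D.B, Sep b x y := by
  obtain ⟨k, hk⟩ := exists_pow_lt_of_lt_one (dist_pos.2 h) (by norm_num : (1 / 2 : ℝ) < 1)
  exact D.sep_exists_aux k x y hk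

theorem circle_compl (z : Circle) : IsPreconnected ({z}ᶜ : Set Circle) := by
  obtain ⟨θ, rfl⟩ := Circle.exp_surjective z
  have : ({Circle.exp θ}ᶜ : Set Circle) = Circle.exp '' Set.Ioo θ (θ + 2 * Real.pi) := by
    ext w
    constructor
    · intro hw
      obtain ⟨φ, rfl⟩ := Circle.exp_surjective w
      have hmem := toIcoMod_mem_Ico Real.two_pi_pos θ φ
      have he : Circle.exp (toIcoMod Real.two_pi_pos θ φ) = Circle.exp φ := by
        rw [Circle.exp_eq_exp]
        refine ⟨-toIcoDiv Real.two_pi_pos θ φ, ?_⟩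
        have := self_sub_toIcoDiv_zsmul Real.two_pi_pos θ φ
        rw [zsmul_eq_mul] at this
        rw [← this]; push_cast; ring
      refine ⟨toIcoMod Real.two_pi_pos θ φ, ⟨lt_of_le_of_ne hmem.1 ?_, hmem.2⟩, he⟩
      intro h
      apply hw
      rw [← he, ← h]; rfl
    · rintro ⟨φ, ⟨h1, h2⟩, rfl⟩ h
      obtain ⟨k, hk⟩ := Circle.exp_eq_exp.1 h
      have hpi := Real.two_pi_pos
      have k1 : (0 : ℝ) < k := by
        by_contra hc; push Not at hc; nlinarith
      have k2 : (k : ℝ) < 1 := by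
        by_contra hc; push Not at hc; nlinarith
      have k1' : 0 < k := by exact_mod_cast k1
      have k2' : k < 1 := by exact_mod_cast k2
      omega
  rw [this]
  exact isPreconnected_Ioo.image _ Circle.exp.continuous.continuousOn

theorem no_circle (D : Dend m X) (S : Set X) : IsEmpty (S ≃ₜ Circle) := by
  constructor
  intro e
  have hne : (1 : Circle) ≠ Circle.exp Real.pi := by
    intro h
    have := congrArg (fun z : Circle => (z : ℂ)) h
    simp [Circle.coe_exp, Complex.exp_pi_mul_I] at this
    norm_num [Complex.ext_iff] at this
  obtain ⟨b, hb, hs⟩ := D.sep_exists (x := (e.symm 1 : X)) (y := (e.symm (Circle.exp Real.pi) : X))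
    (fun h => hne (e.symm.injective (Subtype.ext h)))
  have hc : Continuous (fun z => (e.symm z : X)) := continuous_subtype_val.comp e.symm.continuous
  have key : ∃ z : Circle, ∀ w, w ≠ z → (e.symm w : X) ≠ b := by
    by_cases hbS : b ∈ S
    · refine ⟨e ⟨b, hbS⟩, fun w hw h => hw ?_⟩
      rw [← e.apply_symm_apply w]
      congr 1
      exact Subtype.ext h
    · exact ⟨1, fun w _ h => hbS (h ▸ (e.symm w).2)⟩
  obtain ⟨z, hz⟩ := key
  by_cases h1 : z = 1 ∨ z = Circle.exp Real.pi
  · by_cases hbz : (e.symm z : X) = b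
    · rcases h1 with rfl | rfl
      · exact hs.ne_left hbz
      · exact hs.ne_right hbz
    · refine hs.not_preconn (S := Set.range fun z => (e.symm z : X)) ?_ ?_ ⟨1, rfl⟩ ⟨_, rfl⟩
      · have huniv : IsPreconnected (Set.univ : Set Circle) := by
          have := isPreconnected_univ.image Circle.exp Circle.exp.continuous.continuousOn
          rwa [Set.image_univ, Circle.exp_surjective.range_eq] at this
        rw [← Set.image_univ]
        exact huniv.image _ hc.continuousOn
      · rintro ⟨w, hw⟩
        by_cases hwz : w = z
        · subst hwz; exact hbz hw
        · exact hz w hwz hw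
  · push Not at h1
    refine hs.not_preconn (S := (fun z => (e.symm z : X)) '' {z}ᶜ)
      ((circle_compl z).image _ hc.continuousOn) ?_ ⟨1, fun h => h1.1 h.symm, rfl⟩
      ⟨_, fun h => h1.2 h.symm, rfl⟩
    rintro ⟨w, hw, h⟩
    exact hz w hw h

theorem arc_B (A : Set X) (e : A ≃ₜ unitInterval) : ∃ b ∈ A, b ∈ D.B := by
  have hc : Continuous (fun z => (e.symm z : X)) := continuous_subtype_val.comp e.symm.continuous
  obtain ⟨b, hb, hs⟩ := D.sep_exists (x := (e.symm 0 : X)) (y := (e.symm 1 : X))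
    (fun h => zero_ne_one (e.symm.injective (Subtype.ext h)))
  refine ⟨b, ?_, hb⟩
  by_contra hbA
  refine hs.not_preconn (S := Set.range fun z => (e.symm z : X)) (isPreconnected_range hc) ?_
    ⟨0, rfl⟩ ⟨1, rfl⟩
  rintro ⟨w, hw⟩
  exact hbA (hw ▸ (e.symm w).2)

theorem comp_Q {i : Fin (m + 3)} {x : X} (hx : x ∈ D.Q i) :
    connectedComponentIn {D.c}ᶜ x = D.Q i := by
  have hsub : D.Q i ⊆ {D.c}ᶜ := fun y hy h => D.Q_c i (h ▸ hy)
  apply Set.Subset.antisymm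
  · apply isPreconnected_connectedComponentIn.subset_left_of_subset_union (D.Q_open i)
      (D.f_closedEmb i).isClosed_range.isOpen_compl
      (Set.disjoint_left.2 (by rintro _ ⟨y, _, rfl⟩ h; exact h ⟨y, rfl⟩))
    · rw [Q_union]; exact connectedComponentIn_subset _ _
    · exact ⟨x, mem_connectedComponentIn (hsub hx), hx⟩
  · exact (D.Q_preconn i).subset_connectedComponentIn hx hsub

theorem ptOrder_c : ptOrder X D.c = m + 3 := by
  have h : setComponents X {D.c}ᶜ = D.Q '' Set.univ := by
    ext C
    constructor
    · rintro ⟨x, hx, rfl⟩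
      obtain ⟨i, y, rfl⟩ := D.cover x
      refine ⟨i, trivial, (D.comp_Q ⟨y, ?_, rfl⟩).symm⟩
      rintro rfl
      exact hx (D.f_e0 i)
    · rintro ⟨i, _, rfl⟩
      have hm : D.f i D.e1 ∈ D.Q i := ⟨_, D.ne.symm, rfl⟩
      exact ⟨D.f i D.e1, fun h => D.Q_c i (h ▸ hm), (D.comp_Q hm).symm⟩
  rw [ptOrder, h, Set.ncard_image_of_injective]
  · simp
  · intro i j hij
    by_contra hne
    have hm : D.f i D.e1 ∈ D.Q i := ⟨_, D.ne.symm, rfl⟩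
    rw [hij] at hm
    obtain ⟨z, hz, h⟩ := hm
    exact hz (D.f_ne (Ne.symm hne) h).1

theorem ptOrder_homeo (h : X ≃ₜ X) (p : X) : ptOrder X (h p) = ptOrder X p := by
  have : setComponents X {h p}ᶜ = (fun C => h '' C) '' setComponents X {p}ᶜ := by
    have e : ({h p}ᶜ : Set X) = h '' {p}ᶜ := by
      rw [Set.image_compl_eq h.bijective, Set.image_singleton]
    ext C
    constructor
    · rintro ⟨x, hx, rfl⟩
      rw [e] at hx ⊢
      obtain ⟨y, hy, rfl⟩ := hx
      exact ⟨_, ⟨y, hy, rfl⟩, h.image_connectedComponentIn hy⟩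
    · rintro ⟨_, ⟨y, hy, rfl⟩, rfl⟩
      refine ⟨h y, by rw [e]; exact ⟨y, hy, rfl⟩, ?_⟩
      rw [e]
      exact h.image_connectedComponentIn hy
  rw [ptOrder, ptOrder, this, Set.ncard_image_of_injective]
  exact Set.image_injective.2 h.injective

theorem ptOrder_B {p : X} (hp : p ∈ D.B) : ptOrder X p = m + 3 := by
  obtain ⟨g, -, rfl⟩ := D.G_trans hp
  rw [ptOrder_homeo, ptOrder_c]

theorem nb {p : X} (hp : p ∉ D.B) (w : List (Fin (m + 3))) : ∀ y, p = D.fw w y →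
    ∃ R0 R1 : Set X, IsPreconnected R0 ∧ IsPreconnected R1 ∧ p ∉ R0 ∧ p ∉ R1 ∧
      (∀ x, x ∈ R0 ∨ x ∈ R1 ∨ x ∈ Set.range (D.fw w)) ∧
      (R0 = ∅ ∨ D.fw w D.e0 ∈ R0) ∧ (R1 = ∅ ∨ D.fw w D.e1 ∈ R1) := by
  induction w using List.reverseRecOn with
  | nil =>
    intro y _
    exact ⟨∅, ∅, isPreconnected_empty, isPreconnected_empty, by simp, by simp,
      fun x => Or.inr (Or.inr ⟨x, rfl⟩), Or.inl rfl, Or.inl rfl⟩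
  | append_singleton w i ih =>
    intro y hy
    rw [fw_snoc] at hy
    obtain ⟨R0, R1, h0, h1, hp0, hp1, hc, e0, e1⟩ := ih _ hy
    let M := D.fw w '' D.cells {i}ᶜ
    have hM : IsPreconnected M := (D.cells_preconn _).image _ (D.fw_continuous w).continuousOn
    have hpM : p ∉ M := by
      rintro ⟨_, ⟨j, hj, z, rfl⟩, h⟩
      rw [hy] at h
      have := (D.f_ne hj (D.fw_inj w h)).2
      rw [this, f_e0] at hy
      exact hp (hy ▸ D.fw_c_B w)
    have hcM : D.fw (w ++ [i]) D.e0 ∈ M := by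
      rw [fw_snoc, f_e0]
      obtain ⟨j, hj⟩ := exists_ne i
      exact ⟨_, D.c_mem_cells (i := j) hj, rfl⟩
    have hcov : ∀ x, x ∈ R0 ∨ x ∈ R1 ∨ x ∈ M ∨ x ∈ Set.range (D.fw (w ++ [i])) := by
      intro x
      rcases hc x with h | h | ⟨z, rfl⟩
      · exact Or.inl h
      · exact Or.inr (Or.inl h)
      · obtain ⟨j, z, rfl⟩ := D.cover z
        by_cases hj : j = i
        · subst hj
          exact Or.inr (Or.inr (Or.inr ⟨z, D.fw_snoc w j z⟩))
        · exact Or.inr (Or.inr (Or.inl ⟨_, D.mem_cells hj z, rfl⟩))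
    have un : ∀ R : Set X, IsPreconnected R → ∀ q, q ∈ M → (R = ∅ ∨ q ∈ R) → IsPreconnected (R ∪ M) := by
      rintro R hR q hq (rfl | h)
      · simpa using hM
      · exact IsPreconnected.union q h hq hR hM
    have he0M : i ≠ 0 → D.fw w D.e0 ∈ M := fun hi =>
      ⟨_, ⟨0, Ne.symm hi, D.e1, D.f0e1⟩, rfl⟩
    have he1M : i ≠ 1 → D.fw w D.e1 ∈ M := fun hi =>
      ⟨_, ⟨1, Ne.symm hi, D.e1, D.f1e1⟩, rfl⟩
    by_cases hi0 : i = 0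
    · have hi1 : i ≠ 1 := by subst hi0; simp
      refine ⟨R1 ∪ M, R0, un _ h1 _ (he1M hi1) e1, h0, ?_, hp0, ?_, Or.inr (Or.inr hcM), ?_⟩
      · rintro (h | h); exacts [hp1 h, hpM h]
      · intro x; rcases hcov x with h | h | h | h <;> simp [h]
      · rw [fw_snoc, hi0, D.f0e1]; exact e0
    by_cases hi1 : i = 1
    · refine ⟨R0 ∪ M, R1, un _ h0 _ (he0M hi0) e0, h1, ?_, hp1, ?_, Or.inr (Or.inr hcM), ?_⟩
      · rintro (h | h); exacts [hp0 h, hpM h]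
      · intro x; rcases hcov x with h | h | h | h <;> simp [h]
      · rw [fw_snoc, hi1, D.f1e1]; exact e1
    · refine ⟨(R0 ∪ M) ∪ (R1 ∪ M), ∅, IsPreconnected.union _ (Or.inr hcM) (Or.inr hcM)
        (un _ h0 _ (he0M hi0) e0) (un _ h1 _ (he1M hi1) e1), isPreconnected_empty, ?_, by simp, ?_,
        Or.inr (Or.inl (Or.inr hcM)), Or.inl rfl⟩
      · rintro ((h | h) | (h | h)); exacts [hp0 h, hpM h, hp1 h, hpM h]
      · intro x; rcases hcov x with h | h | h | h <;> simp [h]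

theorem comp_eq_of {p x y : X} {R : Set X} (hR : IsPreconnected R) (hp : p ∉ R) (hx : x ∈ R) (hy : y ∈ R) :
    connectedComponentIn {p}ᶜ x = connectedComponentIn {p}ᶜ y :=
  connectedComponentIn_eq (hR.subset_connectedComponentIn hx
    (fun z hz h => hp ((show z = p from h) ▸ hz)) hy)

theorem no_three {p : X} (hp : p ∉ D.B) {x y z : X} (hx : x ≠ p) (hy : y ≠ p) (hz : z ≠ p) :
    connectedComponentIn {p}ᶜ x = connectedComponentIn {p}ᶜ y ∨
    connectedComponentIn {p}ᶜ x = connectedComponentIn {p}ᶜ z ∨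
    connectedComponentIn {p}ᶜ y = connectedComponentIn {p}ᶜ z := by
  have hpos : 0 < min (dist x p) (min (dist y p) (dist z p)) := by
    simp [dist_pos, hx, hy, hz]
  obtain ⟨k, hk⟩ := exists_pow_lt_of_lt_one hpos (by norm_num : (1 / 2 : ℝ) < 1)
  simp only [lt_min_iff] at hk
  obtain ⟨w, q, hw, hq⟩ := D.fw_cover k p
  obtain ⟨R0, R1, h0, h1, hp0, hp1, hc, -, -⟩ := D.nb hp w q hq
  have out : ∀ x, (1 / 2 : ℝ) ^ k < dist x p → x ∈ R0 ∨ x ∈ R1 := by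
    intro x hx
    rcases hc x with h | h | ⟨s, rfl⟩
    · exact Or.inl h
    · exact Or.inr h
    · rw [hq, fw_dist, hw] at hx
      have := D.dist_le s q
      have h2 : (0 : ℝ) < (1 / 2) ^ k := by positivity
      nlinarith
  rcases out x hk.1 with a | a <;> rcases out y hk.2.1 with b | b <;>
    rcases out z hk.2.2 with c | c
  · exact Or.inl (comp_eq_of h0 hp0 a b)
  · exact Or.inl (comp_eq_of h0 hp0 a b)
  · exact Or.inr (Or.inl (comp_eq_of h0 hp0 a c))
  · exact Or.inr (Or.inr (comp_eq_of h1 hp1 b c))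
  · exact Or.inr (Or.inr (comp_eq_of h0 hp0 b c))
  · exact Or.inr (Or.inl (comp_eq_of h1 hp1 a c))
  · exact Or.inl (comp_eq_of h1 hp1 a b)
  · exact Or.inl (comp_eq_of h1 hp1 a b)

theorem ptOrder_nB {p : X} (hp : p ∉ D.B) : ptOrder X p = 1 ∨ ptOrder X p = 2 := by
  obtain ⟨x, hx⟩ : ∃ x, x ≠ p := by
    by_cases h : D.e0 = p
    · exact ⟨D.e1, fun h' => D.ne (h.trans h'.symm)⟩
    · exact ⟨_, h⟩
  unfold ptOrder
  by_cases hall : ∀ y, y ≠ p → connectedComponentIn {p}ᶜ x = connectedComponentIn {p}ᶜ y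
  · left
    rw [Set.ncard_eq_one]
    refine ⟨connectedComponentIn {p}ᶜ x, ?_⟩
    ext C
    constructor
    · rintro ⟨y, hy, rfl⟩; exact (hall y hy).symm
    · rintro rfl; exact ⟨x, hx, rfl⟩
  · right
    push Not at hall
    obtain ⟨y, hy, hxy⟩ := hall
    rw [Set.ncard_eq_two]
    refine ⟨_, _, hxy, ?_⟩
    ext C
    constructor
    · rintro ⟨z, hz, rfl⟩
      rcases D.no_three hp hx hy hz with h | h | h
      · exact absurd h hxy
      · exact Or.inl h.symm
      · exact Or.inr h.symm
    · rintro (rfl | rfl)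
      · exact ⟨x, hx, rfl⟩
      · exact ⟨y, hy, rfl⟩

theorem homeo_B (h : X ≃ₜ X) {p : X} (hp : p ∈ D.B) : h p ∈ D.B := by
  by_contra hn
  have h1 := D.ptOrder_B hp
  rw [← ptOrder_homeo h] at h1
  rcases D.ptOrder_nB hn with h2 | h2 <;> omega

theorem wazewski (D : Dend m X) : IsWazewskiDendrite (m + 3) X := by
  refine ⟨⟨⟨D.c⟩, inferInstance, ?_, D.locConn, inferInstance, D.no_circle⟩, ?_, ?_⟩
  · haveI := D.preconn
    exact { toNonempty := ⟨D.c⟩ }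
  · intro p
    by_cases hp : p ∈ D.B
    · exact Or.inr (Or.inr (D.ptOrder_B hp))
    · rcases D.ptOrder_nB hp with h | h
      · exact Or.inl h
      · exact Or.inr (Or.inl h)
  · rintro A ⟨e⟩
    obtain ⟨b, hb, hB⟩ := D.arc_B A e
    exact ⟨b, hb, D.ptOrder_B hB⟩

end Dend

namespace Dend

variable {m : ℕ} {X : Type} [MetricSpace X] [CompactSpace X] (D : Dend m X)

/-- b is attached to S at a single point -/
def Adm (S : Set X) (b : X) : Prop := ∃ a ∈ S, b ≠ a ∧ ∀ s ∈ S, s ≠ a → Sep a b s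

theorem Adm.map {S : Set X} {b : X} (h : Adm S b) (g : X ≃ₜ X) : Adm (g '' S) (g b) := by
  obtain ⟨a, ha, hb, hs⟩ := h
  refine ⟨g a, ⟨a, ha, rfl⟩, fun h => hb (g.injective h), ?_⟩
  rintro _ ⟨s, hsS, rfl⟩ hne
  exact (hs s hsS (fun h => hne (by rw [h]))).map g

theorem c_cells (i : Fin (m + 3)) : D.c ∈ D.cells {i}ᶜ := by
  obtain ⟨j, hj⟩ := exists_ne i
  exact D.c_mem_cells (i := j) hj

theorem Adm.lift {S T : Set X} {b : X} (h : Adm S b) (i : Fin (m + 3)) (hT : T ⊆ D.cells {i}ᶜ)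
    (hST : D.e0 ∈ S ∨ T = ∅) : Adm (D.f i '' S ∪ T) (D.f i b) := by
  obtain ⟨a, ha, hb, hs⟩ := h
  refine ⟨D.f i a, Or.inl ⟨a, ha, rfl⟩, fun h => hb (D.f_inj i h), ?_⟩
  by_cases hae : a = D.e0
  · subst hae
    rintro _ (⟨s, hsS, rfl⟩ | hsT) hne
    · have hse : s ≠ D.e0 := fun h => hne (by rw [h])
      exact ((hs s hsS hse).not_preconn D.compl_e0_preconn (by simp) hb hse).elim
    · rw [f_e0] at hne ⊢
      apply D.sep_c hb
      rintro ⟨y, rfl⟩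
      obtain ⟨j, hj, z, hz⟩ := hT hsT
      apply hne
      rw [(D.f_ne hj hz).2, f_e0]
  · rintro _ (⟨s, hsS, rfl⟩ | hsT) hne
    · exact (hs s hsS (fun h => hne (by rw [h]))).lift_f D i hae
    · apply Sep.lift D i _ hae
      obtain ⟨j, hj, z, rfl⟩ := hT hsT
      rw [r_same, D.r_ne hj]
      rcases hST with h | h
      · exact hs _ h (fun h => hae h.symm)
      · rw [h] at hsT; exact hsT.elim

/-- successive attachments -/
def Chain : Set X → List X → Prop
  | _, [] => True
  | S, b :: l => Adm S b ∧ Chain (insert b S) l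

theorem chain_append {S : Set X} {l1 l2 : List X} :
    Chain S (l1 ++ l2) ↔ Chain S l1 ∧ Chain ({x | x ∈ l1} ∪ S) l2 := by
  induction l1 generalizing S with
  | nil => simp [Chain]
  | cons b l ih =>
    simp only [List.cons_append, Chain, ih, and_assoc]
    have : ({x | x ∈ l} ∪ insert b S : Set X) = {x | x ∈ b :: l} ∪ S := by
      ext x; simp only [Set.mem_union, Set.mem_setOf_eq, Set.mem_insert_iff, List.mem_cons]; tauto
    rw [this]

theorem chain_map {S : Set X} {l : List X} (h : Chain S l) (g : X ≃ₜ X) : Chain (g '' S) (l.map g) := by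
  induction l generalizing S with
  | nil => trivial
  | cons b l ih =>
    refine ⟨h.1.map g, ?_⟩
    have := ih h.2
    rwa [Set.image_insert_eq] at this

theorem chain_lift {S T : Set X} {l : List X} (h : Chain S l) (i : Fin (m + 3)) (hT : T ⊆ D.cells {i}ᶜ)
    (hST : D.e0 ∈ S ∨ T = ∅) : Chain (D.f i '' S ∪ T) (l.map (D.f i)) := by
  induction l generalizing S with
  | nil => trivial
  | cons b l ih =>
    refine ⟨h.1.lift D i hT hST, ?_⟩
    have := ih h.2 (hST.imp_left (fun h => Or.inr h))
    rwa [Set.image_insert_eq, Set.insert_union] at this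

theorem chain_lift_e0 {T : Set X} {l : List X} (h : Chain {D.e0} l) (i : Fin (m + 3))
    (hT : T ⊆ D.cells {i}ᶜ) (hc : D.c ∈ T) : Chain T (l.map (D.f i)) := by
  have := D.chain_lift h i hT (Or.inl rfl)
  rw [Set.image_singleton, f_e0] at this
  rwa [Set.union_eq_self_of_subset_left (by simpa using hc)] at this

theorem chain_flatMap {l : List X} (h : Chain {D.e0} l) (I : List (Fin (m + 3))) :
    ∀ S : Set X, I.Nodup → D.c ∈ S → (∀ i ∈ I, S ⊆ D.cells {i}ᶜ) →
      Chain S (I.flatMap fun i => l.map (D.f i)) := by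
  induction I with
  | nil => intros; trivial
  | cons i I ih =>
    intro S hn hc hS
    rw [List.flatMap_cons, chain_append]
    refine ⟨D.chain_lift_e0 h i (hS i (by simp)) hc, ih _ (List.nodup_cons.1 hn).2 (Or.inr hc) ?_⟩
    rintro j hj x (hx | hx)
    · obtain ⟨y, _, rfl⟩ := List.mem_map.1 hx
      apply D.mem_cells
      rintro rfl
      exact (List.nodup_cons.1 hn).1 hj
    · exact hS j (by simp [hj]) hx

theorem chain_exists (k : ℕ) : ∃ l : List X, Chain {D.e0} (l ++ [D.e1]) ∧ (∀ b ∈ l, b ∈ D.B) ∧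
    ∀ p ∈ D.lev k, p ∈ l := by
  induction k with
  | zero =>
    refine ⟨[D.c], ⟨⟨D.e0, rfl, D.c_ne_e0, fun s hs h => absurd hs h⟩,
      ⟨D.c, Or.inl rfl, D.c_ne_e1.symm, ?_⟩, trivial⟩, ?_, ?_⟩
    · rintro s (rfl | rfl) hs
      · exact absurd rfl hs
      · have := D.sep_c_ne (i := 1) (j := 0) (by simp) D.ne.symm D.ne.symm
        rwa [D.f1e1, D.f0e1] at this
    · simp [D.c_B]
    · intro p hp
      rcases D.lev_cases hp with rfl | ⟨i, q, k', h, -, -⟩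
      · simp
      · omega
  | succ k ih =>
    obtain ⟨l, hl, hB, hlev⟩ := ih
    let I : List (Fin (m + 3)) := (List.finRange (m + 3)).filter (fun i => decide (i ≠ 0 ∧ i ≠ 1))
    have hI : ∀ i, i ∈ I ↔ i ≠ 0 ∧ i ≠ 1 := by intro i; simp [I]
    have hIn : I.Nodup := (List.nodup_finRange _).filter _
    let l1 : List X := (l.map D.sg).map (D.f 0)
    let l2 : List X := I.flatMap fun i => l.map (D.f i)
    let l3 : List X := l.map (D.f 1)
    have hl' : Chain {D.e0} l := (chain_append.1 hl).1
    have c1 : Chain {D.e0} (l1 ++ [D.c]) := by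
      have h1 := D.chain_lift (chain_map hl D.sg) 0 (Set.empty_subset _) (Or.inr rfl)
      rw [Set.union_empty, Set.image_singleton, Set.image_singleton, sg_e0, D.f0e1, List.map_append,
        List.map_append, List.map_singleton, List.map_singleton, sg_e1, f_e0] at h1
      exact h1
    have e0m : D.e0 ∈ D.cells {0} := ⟨0, rfl, _, D.f0e1⟩
    have s1 : ∀ x ∈ ({x | x ∈ l1 ++ [D.c]} ∪ {D.e0} : Set X), x ∈ D.cells {0} := by
      rintro x (hx | rfl)
      · rcases List.mem_append.1 hx with hx | hx
        · obtain ⟨y, _, rfl⟩ := List.mem_map.1 hx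
          exact D.mem_cells (Set.mem_singleton 0) y
        · rw [List.mem_singleton.1 hx]
          exact D.c_mem_cells (i := 0) rfl
      · exact e0m
    have sub : ∀ i : Fin (m + 3), i ≠ 0 → D.cells {0} ⊆ D.cells {i}ᶜ := by
      rintro i hi _ ⟨j, rfl, y, rfl⟩
      exact D.mem_cells (Ne.symm hi) y
    have hc1 : D.c ∈ ({x | x ∈ l1 ++ [D.c]} ∪ {D.e0} : Set X) := Or.inl (by simp)
    have c2 : Chain ({x | x ∈ l1 ++ [D.c]} ∪ {D.e0}) l2 :=
      D.chain_flatMap hl' I _ hIn hc1 fun i hi x hx => sub i ((hI i).1 hi).1 (s1 x hx)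
    have c3 : Chain ({x | x ∈ l2} ∪ ({x | x ∈ l1 ++ [D.c]} ∪ {D.e0})) (l3 ++ [D.e1]) := by
      have : l3 ++ [D.e1] = (l ++ [D.e1]).map (D.f 1) := by simp [l3, D.f1e1]
      rw [this]
      refine D.chain_lift_e0 hl 1 ?_ (Or.inr hc1)
      rintro x (hx | hx)
      · obtain ⟨i, hi, hx⟩ := List.mem_flatMap.1 hx
        obtain ⟨y, _, rfl⟩ := List.mem_map.1 hx
        exact D.mem_cells ((hI i).1 hi).2 y
      · exact sub 1 (by simp) (s1 x hx)
    refine ⟨(l1 ++ [D.c]) ++ (l2 ++ l3), ?_, ?_, ?_⟩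
    · rw [List.append_assoc, List.append_assoc l2 l3]
      exact chain_append.2 ⟨c1, chain_append.2 ⟨c2, c3⟩⟩
    · intro b hb
      simp only [List.mem_append, l1, l2, l3, List.mem_map, List.mem_flatMap, List.mem_singleton] at hb
      rcases hb with (⟨_, ⟨y, hy, rfl⟩, rfl⟩ | rfl) | ⟨i, _, y, hy, rfl⟩ | ⟨y, hy, rfl⟩
      · exact D.f_B _ (D.homeo_B _ (hB y hy))
      · exact D.c_B
      · exact D.f_B _ (hB y hy)
      · exact D.f_B _ (hB y hy)
    · intro p hp
      simp only [List.mem_append, l1, l2, l3, List.mem_map, List.mem_flatMap, List.mem_singleton]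
      rcases D.lev_cases hp with rfl | ⟨i, q, k', h, hq, rfl⟩
      · exact Or.inl (Or.inr rfl)
      obtain rfl : k = k' := Nat.succ_injective h
      by_cases h0 : i = 0
      · subst h0
        exact Or.inl (Or.inl ⟨q, ⟨D.sg q, hlev _ (D.sg_lev hq), D.sg_sg q⟩, rfl⟩)
      by_cases h1 : i = 1
      · subst h1
        exact Or.inr (Or.inr ⟨q, hlev _ hq, rfl⟩)
      · exact Or.inr (Or.inl ⟨i, (hI i).2 ⟨h0, h1⟩, q, hlev _ hq, rfl⟩)

theorem chain_c (k : ℕ) : ∃ l : List X, Chain {D.c} l ∧ (∀ b ∈ l, b ∈ D.B) ∧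
    ∀ p ∈ D.lev k, p = D.c ∨ p ∈ l := by
  obtain ⟨l, hl, hB, hlev⟩ := D.chain_exists k
  refine ⟨(List.finRange (m + 3)).flatMap fun i => l.map (D.f i), ?_, ?_, ?_⟩
  · refine D.chain_flatMap (chain_append.1 hl).1 _ _ (List.nodup_finRange _) rfl ?_
    rintro i _ _ rfl
    exact D.c_cells i
  · intro b hb
    simp only [List.mem_map, List.mem_flatMap] at hb
    obtain ⟨i, _, y, hy, rfl⟩ := hb
    exact D.f_B _ (hB y hy)
  · intro p hp
    rcases D.lev_cases hp with rfl | ⟨i, q, k', h, hq, rfl⟩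
    · exact Or.inl rfl
    · right
      simp only [List.mem_map, List.mem_flatMap]
      exact ⟨i, List.mem_finRange i, q, hlev _ (D.lev_mono (by omega) hq), rfl⟩

theorem B_of_f {i : Fin (m + 3)} {b : X} (h : D.f i b ∈ D.B) (hb : b ≠ D.e0) : b ∈ D.B := by
  obtain ⟨w, hw⟩ := h
  cases w with
  | nil => exact absurd (D.f_eq_c hw) hb
  | cons j w =>
    by_cases hij : i = j
    · subst hij
      exact ⟨w, D.f_inj i hw⟩
    · exact absurd (D.f_ne hij hw).1 hb

theorem step_fix {i j : Fin (m + 3)} (k : X ≃ₜ X) {x : X} (hi : x ∉ D.Q i) (hj : x ∉ D.Q j) :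
    (D.loc j k * D.perm (Equiv.swap i j)) x = x := by
  rw [mul_app]
  by_cases hx : x = D.c
  · rw [hx, perm_c, loc_c]
  obtain ⟨l, y, rfl⟩ := D.cover x
  have hy : y ≠ D.e0 := fun h => hx (by rw [h, f_e0])
  have hli : l ≠ i := by rintro rfl; exact hi ⟨y, hy, rfl⟩
  have hlj : l ≠ j := by rintro rfl; exact hj ⟨y, hy, rfl⟩
  rw [perm_f, Equiv.swap_apply_of_ne_of_ne hli hlj, D.loc_ne hlj]

theorem step_c {S : Set X} {b : X} (hb : b ∈ D.B) (hbc : b ≠ D.c) (hs : ∀ s ∈ S, s ≠ D.c → Sep D.c b s)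
    (h : X ≃ₜ X) (hc : h D.c = D.c) (hS : ∀ s ∈ S, h s = s) :
    ∃ g ∈ D.G, (∀ s ∈ S, g s = s) ∧ g b = h b := by
  have hhb : h b ∈ D.B := D.homeo_B h hb
  have hhbc : h b ≠ D.c := fun h' => hbc (h.injective (h'.trans hc.symm))
  obtain ⟨i, b0, rfl⟩ := D.cover b
  obtain ⟨j, b1, hb1⟩ := D.cover (h (D.f i b0))
  have hb0 : b0 ≠ D.e0 := fun h' => hbc (by rw [h', f_e0])
  have hb1' : b1 ≠ D.e0 := fun h' => hhbc (by rw [hb1, h', f_e0])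
  obtain ⟨k0, hk0, h0⟩ := D.Orb_B (D.B_of_f hb hb0)
  obtain ⟨k1, hk1, h1⟩ := D.Orb_B (D.B_of_f (hb1 ▸ hhb) hb1')
  have hK := D.K_mul hk1 (D.K_inv hk0)
  refine ⟨D.loc j (k1 * k0⁻¹) * D.perm (Equiv.swap i j), D.G.mul_mem (D.K_loc hK j) (D.perm_G _), ?_, ?_⟩
  · intro s hsS
    by_cases hsc : s = D.c
    · rw [hsc]; exact D.step_fix _ (D.Q_c _) (D.Q_c _)
    · have hsep := hs s hsS hsc
      apply D.step_fix
      · intro hq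
        exact hsep.not_preconn (D.Q_preconn i) (D.Q_c i) ⟨b0, hb0, rfl⟩ hq
      · intro hq
        have hsep' := hsep.map h
        rw [hc, hS s hsS, hb1] at hsep'
        exact hsep'.not_preconn (D.Q_preconn j) (D.Q_c j) ⟨b1, hb1', rfl⟩ hq
  · rw [mul_app, perm_f, Equiv.swap_apply_left, D.loc_same j hK.1, mul_app, ← h0, inv_app_self, h1, h0, hb1]

theorem step {S : Set X} {b : X} (hSB : S ⊆ D.B) (hb : b ∈ D.B) (ha : Adm S b)
    (h : X ≃ₜ X) (hS : ∀ s ∈ S, h s = s) :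
    ∃ g ∈ D.G, (∀ s ∈ S, g s = s) ∧ g b = h b := by
  obtain ⟨a, haS, hba, hs⟩ := ha
  obtain ⟨u, hu, rfl⟩ := D.G_trans (hSB haS)
  have huc : u⁻¹ (u D.c) = D.c := inv_app_self _ _
  obtain ⟨g, hg, h1, h2⟩ := D.step_c (S := (u⁻¹ : X ≃ₜ X) '' S) (b := u⁻¹ b) (D.homeo_B _ hb)
    (fun h' => hba (by rw [← h', app_inv_self])) (by
      rintro _ ⟨s, hsS, rfl⟩ hne
      have := (hs s hsS (fun h' => hne (by rw [h', huc]))).map u⁻¹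
      rwa [huc] at this) (u⁻¹ * h * u)
    (by rw [mul_app, mul_app, hS _ haS, huc])
    (by
      rintro _ ⟨s, hsS, rfl⟩
      rw [mul_app, mul_app, app_inv_self, hS s hsS])
  refine ⟨u * g * u⁻¹, D.G.mul_mem (D.G.mul_mem hu hg) (D.G.inv_mem hu), ?_, ?_⟩
  · intro s hsS
    rw [mul_app, mul_app, h1 _ ⟨s, hsS, rfl⟩, app_inv_self]
  · rw [mul_app, mul_app, h2, mul_app, mul_app, app_inv_self, app_inv_self]

theorem chain_step (l : List X) : ∀ (S : Set X) (h : X ≃ₜ X), S ⊆ D.B → (∀ b ∈ l, b ∈ D.B) → Chain S l →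
    (∀ s ∈ S, h s = s) → ∃ g ∈ D.G, (∀ s ∈ S, g s = s) ∧ ∀ b ∈ l, g b = h b := by
  induction l with
  | nil => exact fun S h _ _ _ _ => ⟨1, D.G.one_mem, fun _ _ => rfl, by simp⟩
  | cons b l ih =>
    intro S h hSB hl hch hS
    have hb : b ∈ D.B := hl b (by simp)
    obtain ⟨g1, hg1, h1, h2⟩ := D.step hSB hb hch.1 h hS
    obtain ⟨g2, hg2, h3, h4⟩ := ih (insert b S) (g1⁻¹ * h) (Set.insert_subset hb hSB)
      (fun b hb => hl b (by simp [hb])) hch.2 (by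
        rintro s (rfl | hs)
        · rw [mul_app, ← h2, inv_app_self]
        · rw [mul_app, hS s hs]
          conv_lhs => rw [← h1 s hs]
          exact inv_app_self _ _)
    refine ⟨g1 * g2, D.G.mul_mem hg1 hg2, fun s hs => ?_, ?_⟩
    · rw [mul_app, h3 s (Or.inr hs), h1 s hs]
    · intro p hp
      rcases List.mem_cons.1 hp with rfl | hp
      · rw [mul_app, h3 p (Or.inl rfl), h2]
      · rw [mul_app, h4 p hp, mul_app, app_inv_self]

theorem approx_lev (h : X ≃ₜ X) (k : ℕ) : ∃ g ∈ D.G, ∀ p ∈ D.lev k, g p = h p := by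
  obtain ⟨g0, hg0, h0⟩ := D.G_trans (D.homeo_B h D.c_B)
  obtain ⟨l, hl, hB, hlev⟩ := D.chain_c k
  obtain ⟨g, hg, h1, h2⟩ := D.chain_step l {D.c} (g0⁻¹ * h) (by simpa using D.c_B) hB hl (by
    rintro _ rfl
    rw [mul_app, ← h0, inv_app_self])
  refine ⟨g0 * g, D.G.mul_mem hg0 hg, fun p hp => ?_⟩
  rcases hlev p hp with rfl | hp
  · rw [mul_app, h1 _ rfl, h0]
  · rw [mul_app, h2 p hp, mul_app, app_inv_self]

theorem near_id (k : ℕ) : ∀ q : X → X, Continuous q → Function.Injective q → (∀ p ∈ D.lev k, q p = p) →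
    ∀ x, dist (q x) x ≤ (1 / 2 : ℝ) ^ k := by
  induction k with
  | zero => intro q _ _ _ x; simpa using D.dist_le _ _
  | succ k ih =>
    intro q hq hinj hfix x
    obtain ⟨i, y, rfl⟩ := D.cover x
    have hc : q D.c = D.c := hfix _ (D.c_lev _)
    have hsub : q '' D.Q i ⊆ D.Q i := by
      apply ((D.Q_preconn i).image q hq.continuousOn).subset_left_of_subset_union (D.Q_open i)
        (D.f_closedEmb i).isClosed_range.isOpen_compl
        (Set.disjoint_left.2 (by rintro _ ⟨y, _, rfl⟩ h; exact h ⟨y, rfl⟩))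
      · rw [Q_union]
        rintro _ ⟨z, hz, rfl⟩ h
        have h' : q z = q D.c := h.trans hc.symm
        exact D.Q_c i (hinj h' ▸ hz)
      · have hm : D.f i D.c ∈ D.Q i := ⟨_, D.c_ne_e0, rfl⟩
        exact ⟨_, ⟨_, hm, hfix _ (D.f_lev i (D.c_lev k))⟩, hm⟩
    have hqi : ∀ z, D.f i (D.r i (q (D.f i z))) = q (D.f i z) := by
      intro z
      by_cases hz : z = D.e0
      · rw [hz, f_e0, hc, ← D.f_e0 i, r_same]
      · obtain ⟨s, _, hs⟩ := hsub ⟨_, ⟨z, hz, rfl⟩, rfl⟩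
        rw [← hs, r_same]
    have := ih (fun z => D.r i (q (D.f i z)))
      ((D.r_continuous i).comp (hq.comp (D.f_continuous i)))
      (fun a b hab => by
        have h1 := congrArg (D.f i) hab
        change D.f i (D.r i (q (D.f i a))) = D.f i (D.r i (q (D.f i b))) at h1
        rw [hqi, hqi] at h1
        exact D.f_inj i (hinj h1))
      (fun p hp => by
        rw [hfix _ (D.f_lev i hp), r_same]) y
    rw [← hqi, D.dist_same, pow_succ]
    linarith

theorem G_dense : Dense (D.G : Set (X ≃ₜ X)) := by
  intro h
  rw [closure_induced]
  rw [Metric.mem_closure_iff]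
  intro ε he
  obtain ⟨k, hk⟩ := exists_pow_lt_of_lt_one he (by norm_num : (1 / 2 : ℝ) < 1)
  obtain ⟨g, hg, hgl⟩ := D.approx_lev h⁻¹ k
  refine ⟨_, ⟨g⁻¹, D.G.inv_mem hg, rfl⟩, ?_⟩
  have : Nonempty X := ⟨D.c⟩
  rw [ContinuousMap.dist_lt_iff_of_nonempty]
  intro y
  have := D.near_id k (fun x => h (g x)) (h.continuous.comp g.continuous)
    (h.injective.comp g.injective) (fun p hp => by
      rw [hgl p hp, app_inv_self]) (g⁻¹ y)
  simp only [app_inv_self] at this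
  exact this.trans_lt hk

theorem G_FG : D.G.FG := (Subgroup.fg_iff _).2 ⟨D.gens, rfl, D.gens_finite⟩

theorem comm_FG : (commutator D.G).FG := by
  haveI : Group.FG D.G := (Group.fg_iff_subgroup_fg _).2 D.G_FG
  haveI : Finite (Abelianization D.G) := by
    have htor : IsMulTorsion (Abelianization D.G) := by
      have key : ∀ (x : X ≃ₜ X) (hx : x ∈ D.G), IsOfFinOrder (Abelianization.of (⟨x, hx⟩ : D.G)) := by
        intro x hx
        induction hx using Subgroup.closure_induction with
        | mem x hx =>
          apply MonoidHom.isOfFinOrder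
          exact Submonoid.isOfFinOrder_coe.1 (D.gens_fin_order hx)
        | one => exact IsOfFinOrder.one
        | mul x y hx hy h1 h2 =>
          exact (Commute.all _ _).isOfFinOrder_mul h1 h2
        | inv x hx h1 => exact h1.inv
      intro a
      obtain ⟨⟨x, hx⟩, rfl⟩ := QuotientGroup.mk_surjective a
      exact key x hx
    haveI : Group.FG (Abelianization D.G) :=
      Group.fg_of_surjective (f := Abelianization.of) QuotientGroup.mk_surjective
    exact CommGroup.finite_of_fg_isMulTorsion _ htor
  haveI : Finite (D.G ⧸ commutator D.G) := this
  haveI : (commutator D.G).FiniteIndex := Subgroup.finiteIndex_of_finite_quotient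
  rw [← Group.fg_iff_subgroup_fg]
  infer_instance

end Dend

/-- sequences of letters -/
def Sq (m : ℕ) : Type := ℕ → Fin (m + 3)

namespace Sq

variable {m : ℕ}

/-- add a letter -/
def cons (i : Fin (m + 3)) (u : Sq m) : Sq m := fun n => Nat.casesOn n i u
/-- remove a letter -/
def tail (x : Sq m) : Sq m := fun n => x (n + 1)

theorem cons_zero (i : Fin (m + 3)) (u : Sq m) : cons i u 0 = i := rfl
theorem cons_succ (i : Fin (m + 3)) (u : Sq m) (n : ℕ) : cons i u (n + 1) = u n := rfl
theorem tail_cons (i : Fin (m + 3)) (u : Sq m) : tail (cons i u) = u := rfl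
theorem exists_cons (x : Sq m) : ∃ i u, x = cons i u :=
  ⟨x 0, tail x, funext fun n => by cases n <;> rfl⟩

/-- flip the first letter -/
def flip (x : Sq m) : Sq m := cons (Equiv.swap 0 1 (x 0)) (tail x)

theorem flip_cons (i : Fin (m + 3)) (u : Sq m) : flip (cons i u) = cons (Equiv.swap 0 1 i) u := rfl

/-- the shift map -/
def sh (x : Sq m) : Sq m := if x 0 = 0 then flip (tail x) else tail x

/-- the digit -/
noncomputable def dg (x : Sq m) : ℝ := if x 0 = 0 then 0 else 1

/-- the height -/
noncomputable def ht (x : Sq m) : ℝ := ∑' k : ℕ, (1 / 2 : ℝ) ^ (k + 1) * dg (sh^[k] x)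

theorem dg_nonneg (x : Sq m) : 0 ≤ dg x := by unfold dg; split_ifs <;> norm_num
theorem dg_le (x : Sq m) : dg x ≤ 1 := by unfold dg; split_ifs <;> norm_num

theorem geom_summable : Summable fun k : ℕ => (1 / 2 : ℝ) ^ (k + 1) :=
  (summable_nat_add_iff 1).2 (summable_geometric_of_lt_one (by norm_num) (by norm_num))

theorem ht_summable (x : Sq m) : Summable fun k : ℕ => (1 / 2 : ℝ) ^ (k + 1) * dg (sh^[k] x) := by
  refine Summable.of_nonneg_of_le (fun k => mul_nonneg (by positivity) (dg_nonneg _)) (fun k => ?_) geom_summable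
  exact mul_le_of_le_one_right (by positivity) (dg_le _)

theorem ht_nonneg (x : Sq m) : 0 ≤ ht x :=
  tsum_nonneg fun k => mul_nonneg (by positivity) (dg_nonneg _)

theorem ht_rec (x : Sq m) : ht x = dg x / 2 + ht (sh x) / 2 := by
  unfold ht
  rw [(ht_summable x).tsum_eq_zero_add, ← tsum_div_const]
  congr 1
  · simp; ring
  · congr 1
    funext k
    rw [Function.iterate_succ_apply, pow_succ]
    ring

theorem ht_le (x : Sq m) : ht x ≤ 1 := by
  have h : ∑' k : ℕ, (1 / 2 : ℝ) ^ (k + 1) = 1 := by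
    simp_rw [pow_succ]
    rw [tsum_mul_right, tsum_geometric_of_lt_one (by norm_num) (by norm_num)]; norm_num
  rw [← h]
  exact (ht_summable x).tsum_le_tsum (fun k => mul_le_of_le_one_right (by positivity) (dg_le _)) geom_summable

theorem ht_zero (u : Sq m) : ht (cons 0 u) = ht (flip u) / 2 := by
  rw [ht_rec]
  simp [dg, sh, cons_zero, tail_cons]

theorem ht_ne {i : Fin (m + 3)} (hi : i ≠ 0) (u : Sq m) : ht (cons i u) = 1 / 2 + ht u / 2 := by
  rw [ht_rec]
  simp [dg, sh, cons_zero, tail_cons, hi]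

/-- first difference at `k` -/
def Cd (x y : Sq m) (k : ℕ) : Prop := (∀ j < k, x j = y j) ∧ x k ≠ y k

/-- drop letters -/
def drop (k : ℕ) (x : Sq m) : Sq m := fun n => x (n + k)

open Classical in
/-- terms of the distance -/
noncomputable def tm (x y : Sq m) (k : ℕ) : ℝ :=
  if Cd x y k then (1 / 2 : ℝ) ^ (k + 1) * (ht (drop (k + 1) x) + ht (drop (k + 1) y)) else 0

theorem Cd_comm (x y : Sq m) (k : ℕ) : Cd x y k ↔ Cd y x k :=
  ⟨fun h => ⟨fun j hj => (h.1 j hj).symm, h.2.symm⟩, fun h => ⟨fun j hj => (h.1 j hj).symm, h.2.symm⟩⟩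

/-- the distance -/
noncomputable def ds (x y : Sq m) : ℝ := ∑' k : ℕ, tm x y k

theorem tm_nonneg (x y : Sq m) (k : ℕ) : 0 ≤ tm x y k := by
  unfold tm
  split_ifs
  · exact mul_nonneg (by positivity) (add_nonneg (ht_nonneg _) (ht_nonneg _))
  · exact le_rfl

theorem tm_le (x y : Sq m) (k : ℕ) : tm x y k ≤ (1 / 2 : ℝ) ^ k := by
  unfold tm
  split_ifs
  · rw [pow_succ, mul_assoc]
    apply mul_le_of_le_one_right (by positivity)
    have h1 := ht_le (drop (k + 1) x)
    have h2 := ht_le (drop (k + 1) y)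
    linarith
  · positivity

theorem tm_summable (x y : Sq m) : Summable (tm x y) :=
  Summable.of_nonneg_of_le (tm_nonneg x y) (tm_le x y)
    (summable_geometric_of_lt_one (by norm_num) (by norm_num))

theorem ds_nonneg (x y : Sq m) : 0 ≤ ds x y := tsum_nonneg (tm_nonneg x y)

theorem ds_le_two (x y : Sq m) : ds x y ≤ 2 := by
  have h : ∑' k : ℕ, (1 / 2 : ℝ) ^ k = 2 := by
    rw [tsum_geometric_of_lt_one (by norm_num) (by norm_num)]; norm_num
  rw [← h]
  exact (tm_summable x y).tsum_le_tsum (tm_le x y) (summable_geometric_of_lt_one (by norm_num) (by norm_num))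

theorem ds_comm (x y : Sq m) : ds x y = ds y x := by
  unfold ds tm
  congr 1
  funext k
  by_cases h : Cd x y k
  · rw [if_pos h, if_pos ((Cd_comm x y k).1 h), add_comm (ht (drop (k + 1) x))]
  · rw [if_neg h, if_neg (fun h' => h ((Cd_comm x y k).2 h'))]

theorem ds_self (x : Sq m) : ds x x = 0 := by
  have h : ∀ k, tm x x k = 0 := fun k => if_neg fun h => h.2 rfl
  unfold ds
  simp [h]

theorem forall_succ_iff {P : ℕ → Prop} {k : ℕ} : (∀ j < k + 1, P j) ↔ P 0 ∧ ∀ j < k, P (j + 1) := by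
  constructor
  · exact fun h => ⟨h 0 (by omega), fun j hj => h (j + 1) (by omega)⟩
  · rintro ⟨h0, h⟩ j hj
    cases j with
    | zero => exact h0
    | succ j => exact h j (by omega)

theorem ds_same (i : Fin (m + 3)) (u v : Sq m) : ds (cons i u) (cons i v) = ds u v / 2 := by
  unfold ds
  rw [(tm_summable _ _).tsum_eq_zero_add, ← tsum_div_const]
  have h0 : tm (cons i u) (cons i v) 0 = 0 := if_neg fun h => h.2 rfl
  rw [h0, zero_add]
  congr 1
  funext k
  have hc : Cd (cons i u) (cons i v) (k + 1) ↔ Cd u v k := by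
    unfold Cd
    constructor
    · rintro ⟨h, h'⟩
      exact ⟨(forall_succ_iff.1 h).2, h'⟩
    · rintro ⟨h, h'⟩
      exact ⟨forall_succ_iff.2 ⟨rfl, h⟩, h'⟩
  have e : ∀ w : Sq m, drop (k + 1 + 1) (cons i w) = drop (k + 1) w := fun w => rfl
  unfold tm
  by_cases h : Cd u v k
  · rw [if_pos h, if_pos (hc.2 h), e, e, pow_succ]; ring
  · rw [if_neg h, if_neg (fun h' => h (hc.1 h'))]; simp

theorem ds_ne {i j : Fin (m + 3)} (hij : i ≠ j) (u v : Sq m) :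
    ds (cons i u) (cons j v) = (ht u + ht v) / 2 := by
  unfold ds
  rw [(tm_summable _ _).tsum_eq_zero_add]
  have h0 : tm (cons i u) (cons j v) 0 = (ht u + ht v) / 2 := by
    have e : ∀ (l : Fin (m + 3)) (w : Sq m), drop (0 + 1) (cons l w) = w := fun l w => rfl
    have hc : Cd (cons i u) (cons j v) 0 := ⟨fun j hj => absurd hj (by omega), hij⟩
    unfold tm
    rw [if_pos hc, e, e]; ring
  have h1 : ∀ k, tm (cons i u) (cons j v) (k + 1) = 0 := by
    intro k
    unfold tm
    rw [if_neg]
    rintro ⟨h, -⟩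
    exact hij (h 0 (by omega))
  simp [h0, h1]

theorem ds_flip (x y : Sq m) : ds (flip x) (flip y) = ds x y := by
  obtain ⟨i, u, rfl⟩ := exists_cons x
  obtain ⟨j, v, rfl⟩ := exists_cons y
  rw [flip_cons, flip_cons]
  by_cases h : i = j
  · subst h; rw [ds_same, ds_same]
  · rw [ds_ne h, ds_ne (fun h' => h ((Equiv.swap 0 1).injective h'))]

theorem flip_flip (x : Sq m) : flip (flip x) = x := by
  obtain ⟨i, u, rfl⟩ := exists_cons x
  rw [flip_cons, flip_cons, Equiv.swap_apply_self]

theorem le_of_err {a b C : ℝ} (h : ∀ k : ℕ, a ≤ b + C * (1 / 2) ^ k) : a ≤ b := by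
  have ht : Filter.Tendsto (fun k : ℕ => b + C * (1 / 2 : ℝ) ^ k) Filter.atTop (𝓝 (b + C * 0)) :=
    ((tendsto_pow_atTop_nhds_zero_of_lt_one (by norm_num) (by norm_num)).const_mul C).const_add b
  have := ge_of_tendsto' ht h
  linarith

theorem one_ne : (1 : Fin (m + 3)) ≠ 0 := by simp

theorem ht_flip (x : Sq m) : 1 ≤ ht x + ht (flip x) := by
  apply le_of_err (C := 1)
  intro k
  induction k generalizing x with
  | zero => have := ht_nonneg x; have := ht_nonneg (flip x); norm_num; linarith
  | succ k ih =>
    obtain ⟨i, u, rfl⟩ := exists_cons x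
    rw [flip_cons]
    have h1 := ih u
    have h2 : (0 : ℝ) < (1 / 2) ^ k := by positivity
    rw [pow_succ]
    by_cases h0 : i = 0
    · subst h0
      rw [Equiv.swap_apply_left, ht_zero, ht_ne one_ne]
      linarith
    by_cases h1 : i = 1
    · subst h1
      rw [Equiv.swap_apply_right, ht_zero, ht_ne one_ne]
      linarith
    · rw [Equiv.swap_apply_of_ne_of_ne h0 h1, ht_ne h0]
      have := ht_nonneg u
      linarith

theorem ht_sub (x y : Sq m) : ht x ≤ ht y + ds x y := by
  apply le_of_err (C := 1)
  intro k
  induction k generalizing x y with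
  | zero =>
    have := ht_le x; have := ht_nonneg y; have := ds_nonneg x y
    norm_num; linarith
  | succ k ih =>
    obtain ⟨i, u, rfl⟩ := exists_cons x
    obtain ⟨j, v, rfl⟩ := exists_cons y
    have h2 : (0 : ℝ) < (1 / 2) ^ k := by positivity
    have hu := ht_nonneg u
    have hv := ht_nonneg v
    rw [pow_succ]
    by_cases hij : i = j
    · subst hij
      rw [ds_same]
      by_cases hi : i = 0
      · subst hi
        rw [ht_zero, ht_zero]
        have := ih (flip u) (flip v)
        rw [ds_flip] at this
        linarith
      · rw [ht_ne hi, ht_ne hi]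
        have := ih u v
        linarith
    · rw [ds_ne hij]
      by_cases hi : i = 0
      · subst hi
        rw [ht_zero, ht_ne (Ne.symm hij)]
        have := ht_le (flip u)
        linarith
      · rw [ht_ne hi]
        by_cases hj : j = 0
        · subst hj
          rw [ht_zero]
          have := ht_flip v
          linarith
        · rw [ht_ne hj]
          linarith

theorem ds_le_add (x y : Sq m) : ds x y ≤ ht x + ht y := by
  apply le_of_err (C := 2)
  intro k
  induction k generalizing x y with
  | zero =>
    have := ht_nonneg x; have := ht_nonneg y; have := ds_le_two x y
    norm_num; linarith
  | succ k ih =>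
    obtain ⟨i, u, rfl⟩ := exists_cons x
    obtain ⟨j, v, rfl⟩ := exists_cons y
    have h2 : (0 : ℝ) < (1 / 2) ^ k := by positivity
    have hu := ht_nonneg u
    have hv := ht_nonneg v
    have hu' := ht_le u
    have hv' := ht_le v
    rw [pow_succ]
    by_cases hij : i = j
    · subst hij
      rw [ds_same]
      by_cases hi : i = 0
      · subst hi
        rw [ht_zero, ht_zero]
        have := ih (flip u) (flip v)
        rw [ds_flip] at this
        linarith
      · rw [ht_ne hi, ht_ne hi]
        have := ih u v
        linarith
    · rw [ds_ne hij]
      by_cases hi : i = 0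
      · subst hi
        rw [ht_zero, ht_ne (Ne.symm hij)]
        have := ht_nonneg (flip u)
        linarith
      · rw [ht_ne hi]
        by_cases hj : j = 0
        · subst hj
          rw [ht_zero]
          have := ht_nonneg (flip v)
          linarith
        · rw [ht_ne hj]
          linarith

theorem ds_le_one (x y : Sq m) : ds x y ≤ 1 := by
  apply le_of_err (C := 1)
  intro k
  induction k generalizing x y with
  | zero => have := ds_le_two x y; norm_num; linarith
  | succ k ih =>
    obtain ⟨i, u, rfl⟩ := exists_cons x
    obtain ⟨j, v, rfl⟩ := exists_cons y
    have h2 : (0 : ℝ) < (1 / 2) ^ k := by positivity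
    rw [pow_succ]
    by_cases hij : i = j
    · subst hij
      rw [ds_same]
      have := ih u v
      linarith
    · rw [ds_ne hij]
      have := ht_le u
      have := ht_le v
      linarith

theorem ds_triangle (x y z : Sq m) : ds x z ≤ ds x y + ds y z := by
  apply le_of_err (C := 1)
  intro k
  induction k generalizing x y z with
  | zero =>
    have := ds_le_one x z; have := ds_nonneg x y; have := ds_nonneg y z
    norm_num; linarith
  | succ k ih =>
    obtain ⟨i, u, rfl⟩ := exists_cons x
    obtain ⟨j, v, rfl⟩ := exists_cons y
    obtain ⟨l, w, rfl⟩ := exists_cons z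
    have h2 : (0 : ℝ) < (1 / 2) ^ k := by positivity
    have hu := ht_nonneg u
    have hv := ht_nonneg v
    have hw := ht_nonneg w
    rw [pow_succ]
    by_cases hij : i = j
    · subst hij
      rw [ds_same]
      by_cases hil : i = l
      · subst hil
        rw [ds_same, ds_same]
        have := ih u v w
        linarith
      · rw [ds_ne hil, ds_ne hil]
        have := ht_sub u v
        linarith
    · rw [ds_ne hij]
      by_cases hil : i = l
      · subst hil
        rw [ds_same, ds_ne (Ne.symm hij)]
        have := ds_le_add u w
        linarith
      · rw [ds_ne hil]
        by_cases hjl : j = l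
        · subst hjl
          rw [ds_same]
          have := ht_sub w v
          rw [ds_comm] at this
          linarith
        · rw [ds_ne hjl]
          linarith

theorem ds_agree (k : ℕ) : ∀ x y : Sq m, (∀ j < k, x j = y j) → ds x y ≤ (1 / 2 : ℝ) ^ k := by
  induction k with
  | zero => intro x y _; simpa using ds_le_one x y
  | succ k ih =>
    intro x y h
    obtain ⟨i, u, rfl⟩ := exists_cons x
    obtain ⟨j, v, rfl⟩ := exists_cons y
    obtain rfl : i = j := h 0 (by omega)
    rw [ds_same, pow_succ]
    have := ih u v (fun j hj => h (j + 1) (by omega))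
    linarith

noncomputable instance : PseudoMetricSpace (Sq m) where
  dist := ds
  dist_self := ds_self
  dist_comm := ds_comm
  dist_triangle := ds_triangle

theorem dist_def (x y : Sq m) : dist x y = ds x y := rfl

/-- reading a sequence -/
def ofFun (x : ℕ → Fin (m + 3)) : Sq m := x

theorem ofFun_continuous : Continuous (ofFun (m := m)) := by
  rw [continuous_iff_continuousAt]
  intro x
  rw [ContinuousAt, Metric.tendsto_nhds]
  intro ε he
  obtain ⟨k, hk⟩ := exists_pow_lt_of_lt_one he (by norm_num : (1 / 2 : ℝ) < 1)
  have h : ∀ j, ∀ᶠ y : ℕ → Fin (m + 3) in 𝓝 x, y j = x j := by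
    intro j
    have hc : Continuous fun y : ℕ → Fin (m + 3) => y j := continuous_apply j
    exact hc.continuousAt.eventually (IsOpen.mem_nhds (isOpen_discrete {x j}) rfl)
  have h' : ∀ᶠ y : ℕ → Fin (m + 3) in 𝓝 x, ∀ j ∈ Set.Iio k, y j = x j :=
    (Filter.eventually_all_finite (Set.finite_Iio k)).2 fun j _ => h j
  filter_upwards [h'] with y hy
  exact (ds_agree k y x hy).trans_lt hk

instance : CompactSpace (Sq m) := by
  constructor
  have := isCompact_range (ofFun_continuous (m := m))
  have hs : Set.range (ofFun (m := m)) = Set.univ := Set.range_eq_univ.2 (fun x => ⟨x, rfl⟩)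
  rwa [hs] at this

/-- the constant sequence -/
def one : Sq m := fun _ => 1

theorem cons_one : cons 1 (one (m := m)) = one := funext fun n => by cases n <;> rfl

theorem ht_one : ht (one (m := m)) = 1 := by
  have := ht_ne (m := m) one_ne one
  rw [cons_one] at this
  linarith

theorem ht_e0 : ht (cons 0 (one (m := m))) = 0 := by
  have h := ht_zero (m := m) one
  have : flip (one (m := m)) = cons 0 one := by
    conv_lhs => rw [← cons_one]
    rw [flip_cons, Equiv.swap_apply_right]
  rw [this] at h
  linarith

theorem ds_e0 (x : Sq m) : ds (cons 0 one) x = ht x := by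
  have h1 := ds_le_add (cons 0 one) x
  have h2 := ht_sub x (cons 0 one)
  rw [ht_e0] at h1 h2
  rw [ds_comm] at h2
  linarith

end Sq

/-- the dendrite -/
abbrev DX (m : ℕ) : Type := SeparationQuotient (Sq m)

instance (m : ℕ) : CompactSpace (DX m) := by
  constructor
  have := isCompact_range (SeparationQuotient.continuous_mk (X := Sq m))
  rwa [SeparationQuotient.surjective_mk.range_eq] at this

/-- the self-similar structure on the dendrite -/
noncomputable def theDend (m : ℕ) : Dend m (DX m) where
  f i := SeparationQuotient.lift (fun u : Sq m => SeparationQuotient.mk (Sq.cons i u)) (by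
    intro u v h
    apply SeparationQuotient.mk_eq_mk.2
    rw [Metric.inseparable_iff] at h ⊢
    rw [Sq.dist_def] at h ⊢
    rw [Sq.ds_same, h, zero_div])
  e0 := SeparationQuotient.mk (Sq.cons 0 Sq.one)
  e1 := SeparationQuotient.mk Sq.one
  cover x := by
    obtain ⟨x, rfl⟩ := SeparationQuotient.surjective_mk x
    obtain ⟨i, u, rfl⟩ := Sq.exists_cons x
    exact ⟨i, SeparationQuotient.mk u, rfl⟩
  dist_same i x y := by
    obtain ⟨x, rfl⟩ := SeparationQuotient.surjective_mk x
    obtain ⟨y, rfl⟩ := SeparationQuotient.surjective_mk y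
    rw [SeparationQuotient.lift_mk, SeparationQuotient.lift_mk, SeparationQuotient.dist_mk,
      SeparationQuotient.dist_mk]
    exact Sq.ds_same i x y
  dist_ne i j x y hij := by
    obtain ⟨x, rfl⟩ := SeparationQuotient.surjective_mk x
    obtain ⟨y, rfl⟩ := SeparationQuotient.surjective_mk y
    rw [SeparationQuotient.lift_mk, SeparationQuotient.lift_mk, SeparationQuotient.dist_mk,
      SeparationQuotient.dist_mk, SeparationQuotient.dist_mk, Sq.dist_def, Sq.dist_def, Sq.dist_def,
      Sq.ds_e0, Sq.ds_e0]
    exact Sq.ds_ne hij x y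
  f0e1 := rfl
  f1e1 := by rw [SeparationQuotient.lift_mk, Sq.cons_one]
  dist_le x y := by
    obtain ⟨x, rfl⟩ := SeparationQuotient.surjective_mk x
    obtain ⟨y, rfl⟩ := SeparationQuotient.surjective_mk y
    rw [SeparationQuotient.dist_mk]
    exact Sq.ds_le_one x y
  ne := by
    intro h
    have h1 : dist (SeparationQuotient.mk (Sq.cons 0 (Sq.one (m := m)))) (SeparationQuotient.mk Sq.one) = 0 := by
      rw [h, dist_self]
    rw [SeparationQuotient.dist_mk, Sq.dist_def, Sq.ds_e0, Sq.ht_one] at h1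
    exact one_ne_zero h1

theorem statement3 (n : ℕ) (hn : 3 ≤ n) :
    ∃ (X : Type) (_ : TopologicalSpace X) (_ : IsWazewskiDendrite n X)
      (G : Subgroup (X ≃ₜ X)),
      G.FG ∧ Dense (G : Set (X ≃ₜ X)) ∧ (commutator G).FG := by
  obtain ⟨m, rfl⟩ : ∃ m, n = m + 3 := ⟨n - 3, by omega⟩
  exact ⟨DX m, inferInstance, (theDend m).wazewski, (theDend m).G, (theDend m).G_FG,
    (theDend m).G_dense, (theDend m).comm_FG⟩
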